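/- arXiv:math/0105043 — 2 statements merged into one kernel-verified Lean document; each statement's English description precedes it below -/
import Mathlib

section
/- Assume λ > λ₀ and Condition A, with w, ᾱ, α₀, b, T as in Condition A. Let S be any set of positive integers containing no two consecutive integers (i.e., for no j are both j and j+1 in S). Then there exists α ∈ (α₀, ᾱ) such that the solution u_α of (∗) with u_α(0) = α, u_α'(0) = 0 is defined on all of ℝ, and for every positive integer j the following equivalence holds: there exists t with |t − jπ| ≤ T and u_α(t) = (−1)^j · w(|t − jπ|) if and only if j ∈ S. -/
open Real Set

/-- `u` is a global solution, with velocity `v`, of the equation with acceleration `F t u`. -/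
def IsSecondOrderSol (F : ℝ → ℝ → ℝ) (u v : ℝ → ℝ) : Prop :=
  ∀ t, HasDerivAt u (v t) t ∧ HasDerivAt v (F t (u t)) t

/-- First-order system equivalent to the equation with acceleration `F t u`. -/
def phaseField (F : ℝ → ℝ → ℝ) (t : ℝ) (p : ℝ × ℝ) : ℝ × ℝ := (p.2, F t p.1)

lemma lipschitzWith_phaseField {F : ℝ → ℝ → ℝ} {K : NNReal} (hF : ∀ t, LipschitzWith K (F t))
    (t : ℝ) : LipschitzWith (max 1 K) (phaseField F t) := by
  change LipschitzWith (max 1 K) (fun p : ℝ × ℝ => (p.2, F t p.1))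
  have h1 : LipschitzWith 1 (fun p : ℝ × ℝ => p.2) := LipschitzWith.prod_snd
  have h2 : LipschitzWith (K * 1) (fun p : ℝ × ℝ => F t p.1) :=
    (hF t).comp LipschitzWith.prod_fst
  simpa using h1.prodMk h2

lemma IsSecondOrderSol.hasDerivAt_pair {F : ℝ → ℝ → ℝ} {u v : ℝ → ℝ}
    (h : IsSecondOrderSol F u v) (t : ℝ) :
    HasDerivAt (fun s => (u s, v s)) (phaseField F t (u t, v t)) t :=
  (h t).1.prodMk (h t).2

lemma IsSecondOrderSol.continuous {F : ℝ → ℝ → ℝ} {u v : ℝ → ℝ}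
    (h : IsSecondOrderSol F u v) : Continuous u :=
  continuous_iff_continuousAt.2 fun t => (h t).1.continuousAt

lemma IsSecondOrderSol.continuous_velocity {F : ℝ → ℝ → ℝ} {u v : ℝ → ℝ}
    (h : IsSecondOrderSol F u v) : Continuous v :=
  continuous_iff_continuousAt.2 fun t => (h t).2.continuousAt

lemma IsSecondOrderSol.unique {F : ℝ → ℝ → ℝ} {K : NNReal} (hF : ∀ t, LipschitzWith K (F t))
    {u v u' v' : ℝ → ℝ} (h : IsSecondOrderSol F u v) (h' : IsSecondOrderSol F u' v')
    {t₀ : ℝ} (hu : u t₀ = u' t₀) (hv : v t₀ = v' t₀) : u = u' ∧ v = v' := by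
  have := ODE_solution_unique_univ (v := phaseField F) (s := fun _ => univ) (t₀ := t₀)
    (fun t => (lipschitzWith_phaseField hF t).lipschitzOnWith)
    (fun t => ⟨h.hasDerivAt_pair t, mem_univ _⟩) (fun t => ⟨h'.hasDerivAt_pair t, mem_univ _⟩)
    (by simp [hu, hv])
  exact ⟨funext fun t => congrArg Prod.fst (congrFun this t),
    funext fun t => congrArg Prod.snd (congrFun this t)⟩

/-- A bounded Lipschitz second-order equation is solvable on every bounded time interval. -/
lemma exists_secondOrderSol_Ioo {F : ℝ → ℝ → ℝ} {K : NNReal} {C : ℝ}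
    (hF : ∀ t, LipschitzWith K (F t)) (hFc : ∀ x, Continuous fun t => F t x)
    (hC : ∀ t x, |F t x| ≤ C) (α : ℝ) {τ : ℝ} (hτ : 0 < τ) :
    ∃ p : ℝ → ℝ × ℝ, p 0 = (α, 0) ∧ ∀ t ∈ Ioo (-τ) τ, HasDerivAt p (phaseField F t (p t)) t := by
  have hC0 : 0 ≤ C := (abs_nonneg _).trans (hC 0 0)
  set M : ℝ := 1 / (2 * τ) with hM
  have hM0 : 0 < M := by positivity
  have hMτ : M * τ = 1 / 2 := by rw [hM]; field_simp
  set f : ℝ → ℝ × ℝ → ℝ × ℝ := fun t p => (M * p.2, F t p.1 / M) with hf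
  have h0 : (0 : ℝ) ∈ Icc (-τ) τ := ⟨by linarith, hτ.le⟩
  obtain ⟨a, ha⟩ : ∃ a : NNReal, (a : ℝ) = 2 * C * τ ^ 2 + 1 := ⟨⟨_, by positivity⟩, rfl⟩
  obtain ⟨L, hL⟩ : ∃ L : NNReal, (L : ℝ) = (2 * C * τ ^ 2 + 1) / τ := ⟨⟨_, by positivity⟩, rfl⟩
  have hpl : IsPicardLindelof f (⟨0, h0⟩ : Icc (-τ) τ) (α, 0)
      a 0 L (max (Real.nnabs M * 1) (Real.nnabs M⁻¹ * (K * 1))) := by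
    refine ⟨fun t _ => LipschitzWith.lipschitzOnWith ?_, fun x _ => ?_, fun t _ x hx => ?_, ?_⟩
    · have h1 : LipschitzWith (Real.nnabs M * 1) (fun p : ℝ × ℝ => M * p.2) := by
        have : LipschitzWith (Real.nnabs M) (fun x : ℝ => M * x) :=
          LipschitzWith.of_dist_le_mul fun x y => by
            simp [Real.dist_eq, ← mul_sub, abs_mul]
        exact this.comp LipschitzWith.prod_snd
      have h2 : LipschitzWith (Real.nnabs M⁻¹ * (K * 1)) (fun p : ℝ × ℝ => F t p.1 / M) := by
        have : LipschitzWith (Real.nnabs M⁻¹) (fun x : ℝ => x / M) :=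
          LipschitzWith.of_dist_le_mul fun x y => by
            simp [Real.dist_eq, div_eq_inv_mul, ← mul_sub, abs_mul]
        exact this.comp ((hF t).comp LipschitzWith.prod_fst)
      exact h1.prodMk h2
    · exact (Continuous.prodMk continuous_const ((hFc x.1).div_const M)).continuousOn
    · have hx2 : |x.2| ≤ 2 * C * τ ^ 2 + 1 := by
        rw [← ha]
        have := (Prod.dist_eq (x := x) (y := (α, (0 : ℝ)))) ▸ Metric.mem_closedBall.1 hx
        simpa [Real.dist_eq] using (le_max_right _ _).trans this
      rw [Prod.norm_def]
      refine max_le ?_ ?_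
      · simp only [hf, norm_mul, Real.norm_eq_abs, abs_of_pos hM0, hL]
        rw [le_div_iff₀ hτ]
        nlinarith [abs_nonneg x.2]
      · simp only [hf, norm_div, Real.norm_eq_abs, abs_of_pos hM0, hL]
        rw [div_le_div_iff₀ hM0 hτ]
        have h3 := hC t x.1
        have h4 : M * (2 * C * τ ^ 2) = C * τ := by
          calc M * (2 * C * τ ^ 2) = (M * τ) * (2 * C * τ) := by ring
            _ = C * τ := by rw [hMτ]; ring
        nlinarith
    · simp only [ha, hL, sub_zero, NNReal.coe_zero, zero_sub, neg_neg, max_self]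
      exact (div_mul_cancel₀ _ hτ.ne').le
  obtain ⟨q, hq0, hq⟩ := hpl.exists_eq_forall_mem_Icc_hasDerivWithinAt₀
  refine ⟨fun t => ((q t).1, M * (q t).2), ?_, fun t ht => ?_⟩
  · have : q 0 = (α, 0) := hq0
    simp [this]
  · have h1 : HasDerivAt q (f t (q t)) t :=
      (hq t (Ioo_subset_Icc_self ht)).hasDerivAt (Icc_mem_nhds ht.1 ht.2)
    have h2 : HasDerivAt (fun s => (q s).1) (M * (q t).2) t := h1.fst
    have h3 : HasDerivAt (fun s => (q s).2) (F t (q t).1 / M) t := h1.snd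
    have h4 := h3.const_mul M
    rw [mul_div_cancel₀ _ hM0.ne'] at h4
    exact h2.prodMk h4

/-- A bounded Lipschitz second-order equation has global solutions starting at rest. -/
lemma exists_secondOrderSol {F : ℝ → ℝ → ℝ} {K : NNReal} {C : ℝ}
    (hF : ∀ t, LipschitzWith K (F t)) (hFc : ∀ x, Continuous fun t => F t x)
    (hC : ∀ t x, |F t x| ≤ C) (α : ℝ) :
    ∃ u v : ℝ → ℝ, IsSecondOrderSol F u v ∧ u 0 = α ∧ v 0 = 0 := by
  have h := fun n : ℕ => exists_secondOrderSol_Ioo hF hFc hC α (τ := (n : ℝ) + 1) (by positivity)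
  choose p hp0 hp using h
  have hmono : ∀ m n : ℕ, m ≤ n → ∀ t ∈ Ioo (-((m : ℝ) + 1)) (m + 1), p m t = p n t := by
    intro m n hmn t ht
    have hmn' : (m : ℝ) ≤ n := by exact_mod_cast hmn
    have hm : (0 : ℝ) ≤ m := m.cast_nonneg
    exact ODE_solution_unique_of_mem_Ioo (v := phaseField F) (s := fun _ => univ)
      (t₀ := 0) (K := max 1 K) (fun s _ => (lipschitzWith_phaseField hF s).lipschitzOnWith)
      ⟨by linarith, by linarith⟩ (fun s hs => ⟨hp m s hs, mem_univ _⟩)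
      (fun s hs => ⟨hp n s ⟨by linarith [hs.1], by linarith [hs.2]⟩, mem_univ _⟩)
      ((hp0 m).trans (hp0 n).symm) ht
  set q : ℝ → ℝ × ℝ := fun t => p ⌈|t|⌉₊ t with hq
  have hqn : ∀ n : ℕ, ∀ t ∈ Ioo (-((n : ℝ) + 1)) (n + 1), q t = p n t := by
    intro n t ht
    have h1 : |t| ≤ ⌈|t|⌉₊ := Nat.le_ceil _
    have h2 := abs_le.1 h1
    rcases le_total ⌈|t|⌉₊ n with h | h
    · exact hmono _ _ h t ⟨by linarith, by linarith⟩
    · exact (hmono _ _ h t ht).symm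
  have hqd : ∀ t, HasDerivAt q (phaseField F t (q t)) t := by
    intro t
    have h2 := abs_le.1 (Nat.le_ceil |t|)
    have hmem : t ∈ Ioo (-((⌈|t|⌉₊ : ℝ) + 1)) (⌈|t|⌉₊ + 1) := ⟨by linarith, by linarith⟩
    have := hp _ t hmem
    rw [← hqn _ t hmem] at this
    refine this.congr_of_eventuallyEq ?_
    filter_upwards [Ioo_mem_nhds hmem.1 hmem.2] with s hs using hqn _ s hs
  have h00 : q 0 = (α, 0) := by simp [hq, hp0]
  exact ⟨fun t => (q t).1, fun t => (q t).2, fun t => ⟨(hqd t).fst, (hqd t).snd⟩,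
    by simp [h00], by simp [h00]⟩

/-- Solutions starting at rest depend jointly continuously on position and forward time. -/
lemma continuous_secondOrderSol {F : ℝ → ℝ → ℝ} {K : NNReal} (hF : ∀ t, LipschitzWith K (F t))
    {U V : ℝ → ℝ → ℝ} (h : ∀ α, IsSecondOrderSol F (U α) (V α)) (hU : ∀ α, U α 0 = α)
    (hV : ∀ α, V α 0 = 0) :
    ContinuousOn (fun q : ℝ × ℝ => U q.1 q.2) {q | 0 ≤ q.2} := by
  have key : ∀ α β t, 0 ≤ t → |U α t - U β t| ≤ |α - β| * exp ((max 1 K : NNReal) * t) := by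
    intro α β t ht
    have := dist_le_of_trajectories_ODE (v := phaseField F) (a := 0) (b := t)
      (f := fun s => (U α s, V α s)) (g := fun s => (U β s, V β s)) (δ := |α - β|)
      (lipschitzWith_phaseField hF)
      (fun s _ => ((h α).hasDerivAt_pair s).continuousAt.continuousWithinAt)
      (fun s _ => ((h α).hasDerivAt_pair s).hasDerivWithinAt)
      (fun s _ => ((h β).hasDerivAt_pair s).continuousAt.continuousWithinAt)
      (fun s _ => ((h β).hasDerivAt_pair s).hasDerivWithinAt)
      (by simp [hU, hV, Prod.dist_eq, Real.dist_eq]) t ⟨ht, le_rfl⟩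
    rw [Prod.dist_eq, sub_zero] at this
    exact (le_max_left _ _).trans this
  rintro ⟨α, t⟩ ht
  change 0 ≤ t at ht
  rw [ContinuousWithinAt, tendsto_iff_dist_tendsto_zero]
  have hub : Filter.Tendsto (fun q : ℝ × ℝ => |q.1 - α| * exp ((max 1 K : NNReal) * q.2)
      + |U α q.2 - U α t|) (nhdsWithin (α, t) {q | 0 ≤ q.2}) (nhds 0) := by
    have hc := (h α).continuous
    have : Continuous (fun q : ℝ × ℝ => |q.1 - α| * exp ((max 1 K : NNReal) * q.2)
      + |U α q.2 - U α t|) := by fun_prop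
    have h2 := (this.tendsto (α, t)).mono_left (nhdsWithin_le_nhds (s := {q | 0 ≤ q.2}))
    simpa using h2
  refine squeeze_zero' (Filter.Eventually.of_forall fun _ => dist_nonneg) ?_ hub
  filter_upwards [self_mem_nhdsWithin] with q hq
  calc dist (U q.1 q.2) (U α t) ≤ dist (U q.1 q.2) (U α q.2) + dist (U α q.2) (U α t) :=
        dist_triangle _ _ _
    _ ≤ _ := add_le_add (key _ _ _ hq) le_rfl

/-- Acceleration in the Duffing equation, with the displacement clipped to `[-b, b]`. -/
noncomputable def clippedField (ε lam b t x : ℝ) : ℝ :=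
  ((max (-b) (min b x)) ^ 3 - lam * max (-b) (min b x) + cos t) / ε ^ 2

lemma clippedField_of_mem {ε lam b t x : ℝ} (hx : x ∈ Icc (-b) b) :
    clippedField ε lam b t x = (x ^ 3 - lam * x + cos t) / ε ^ 2 := by
  rw [clippedField, min_eq_right hx.2, max_eq_right hx.1]

lemma exists_lipschitzWith_clippedField (ε lam : ℝ) {b : ℝ} (hb : 0 < b) :
    ∃ K : NNReal, ∀ t, LipschitzWith K (clippedField ε lam b t) := by
  refine ⟨⟨(3 * b ^ 2 + |lam|) / ε ^ 2, by positivity⟩, fun t =>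
    LipschitzWith.of_dist_le_mul fun x y => ?_⟩
  set c : ℝ → ℝ := fun x => max (-b) (min b x) with hc
  have hcb : ∀ x, |c x| ≤ b := fun x =>
    abs_le.2 ⟨le_max_left _ _, max_le (by linarith) (min_le_left _ _)⟩
  have hcl : |c x - c y| ≤ |x - y| := by
    refine (abs_max_sub_max_le_max (-b) (min b x) (-b) (min b y)).trans (max_le (by simp) ?_)
    exact (abs_min_sub_min_le_max b x b y).trans (max_le (by simp) le_rfl)
  have h1 : clippedField ε lam b t x - clippedField ε lam b t y
      = (c x - c y) * (c x ^ 2 + c x * c y + c y ^ 2 - lam) / ε ^ 2 := by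
    simp only [clippedField, hc]; ring
  have h2 : |c x ^ 2 + c x * c y + c y ^ 2 - lam| ≤ 3 * b ^ 2 + |lam| := by
    obtain ⟨hx1, hx2⟩ := abs_le.1 (hcb x)
    obtain ⟨hy1, hy2⟩ := abs_le.1 (hcb y)
    refine (abs_sub _ _).trans (add_le_add (abs_le.2 ⟨?_, ?_⟩) le_rfl)
    · nlinarith [sq_nonneg (c x + c y), sq_nonneg (c x), sq_nonneg (c y)]
    · nlinarith [mul_nonneg (sub_nonneg.2 hx2) (sub_nonneg.2 hy2),
        mul_nonneg (sub_nonneg.2 hx1) (sub_nonneg.2 hy1)]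
  rw [Real.dist_eq, Real.dist_eq, h1, abs_div, abs_mul, abs_of_nonneg (sq_nonneg ε)]
  change _ ≤ (3 * b ^ 2 + |lam|) / ε ^ 2 * |x - y|
  rw [div_mul_eq_mul_div, mul_comm]
  gcongr

lemma exists_abs_clippedField_le (ε lam : ℝ) {b : ℝ} (hb : 0 < b) :
    ∃ C, ∀ t x, |clippedField ε lam b t x| ≤ C := by
  refine ⟨(b ^ 3 + |lam| * b + 1) / ε ^ 2, fun t x => ?_⟩
  set c := max (-b) (min b x) with hc
  have hcb : |c| ≤ b := abs_le.2 ⟨le_max_left _ _, max_le (by linarith) (min_le_left _ _)⟩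
  rw [clippedField, abs_div, abs_of_nonneg (sq_nonneg ε), ← hc]
  gcongr
  refine (abs_add_le _ _).trans (add_le_add ((abs_sub _ _).trans (add_le_add ?_ ?_))
    (abs_cos_le_one t))
  · rw [abs_pow]; gcongr
  · rw [abs_mul]; gcongr

lemma clippedField_neg (ε lam : ℝ) {b : ℝ} (hb : 0 < b) (t x : ℝ) :
    clippedField ε lam b (t + π) (-x) = -clippedField ε lam b t x := by
  have : max (-b) (min b (-x)) = -max (-b) (min b x) := by
    rcases le_total x (-b) with h | h
    · rw [min_eq_left (by linarith), min_eq_right (by linarith), max_eq_left h,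
        max_eq_right (by linarith)]
      ring
    · rcases le_total x b with h' | h'
      · rw [min_eq_right (by linarith), min_eq_right h', max_eq_right h, max_eq_right (by linarith)]
      · rw [min_eq_right (by linarith), min_eq_left h', max_eq_left (by linarith),
          max_eq_right (by linarith)]
  rw [clippedField, clippedField, this, cos_add_pi]
  ring

lemma clippedField_time_neg (ε lam b t x : ℝ) :
    clippedField ε lam b (-t) x = clippedField ε lam b t x := by
  simp [clippedField]

lemma IsSecondOrderSol.reflect {ε lam b : ℝ} {u v : ℝ → ℝ}
    (h : IsSecondOrderSol (clippedField ε lam b) u v) :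
    IsSecondOrderSol (clippedField ε lam b) (fun t => u (-t)) (fun t => -v (-t)) := by
  intro t
  obtain ⟨h1, h2⟩ := h (-t)
  refine ⟨?_, ?_⟩
  · simpa [Function.comp_def] using h1.scomp t (hasDerivAt_neg t)
  · have := (h2.scomp t (hasDerivAt_neg t)).neg
    simpa [Function.comp_def, clippedField_time_neg, Pi.neg_def] using this

lemma IsSecondOrderSol.shift {ε lam b : ℝ} (hb : 0 < b) {u v : ℝ → ℝ}
    (h : IsSecondOrderSol (clippedField ε lam b) u v) (n : ℕ) :
    IsSecondOrderSol (clippedField ε lam b) (fun t => (-1) ^ n * u (n * π + t))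
      (fun t => (-1) ^ n * v (n * π + t)) := by
  have step : ∀ {u v : ℝ → ℝ}, IsSecondOrderSol (clippedField ε lam b) u v →
      IsSecondOrderSol (clippedField ε lam b) (fun t => -u (π + t)) (fun t => -v (π + t)) := by
    intro u v h t
    obtain ⟨h1, h2⟩ := h (π + t)
    refine ⟨(h1.comp_const_add π t).neg, ?_⟩
    have e : clippedField ε lam b t (-u (π + t)) = -clippedField ε lam b (π + t) (u (π + t)) := by
      rw [← clippedField_neg ε lam hb, show π + t + π = t + 2 * π by ring]
      simp [clippedField]
    rw [e]
    exact (h2.comp_const_add π t).neg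
  induction n with
  | zero => simpa using h
  | succ n ih =>
    convert step ih using 3 with t t
    · push_cast; ring_nf
    · push_cast; ring_nf

/-- A solution cannot have a local maximum where it is accelerating upwards. -/
lemma not_isLocalMax_of_accel_pos {u v : ℝ → ℝ} {a t₀ : ℝ} (hu : ∀ t, HasDerivAt u (v t) t)
    (hv : HasDerivAt v a t₀) (ha : 0 < a) : ¬IsLocalMax u t₀ := by
  intro hmax
  have hd : deriv u = v := funext fun t => (hu t).deriv
  have hmin : IsLocalMin u t₀ := isLocalMin_of_deriv_deriv_pos
    (by rw [hd, hv.deriv]; exact ha) hmax.deriv_eq_zero (hu t₀).continuousAt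
  have h1 : u =ᶠ[nhds t₀] fun _ => u t₀ := by
    filter_upwards [hmax, hmin] with t h1 h2 using le_antisymm h1 h2
  have h2 := h1.deriv.deriv_eq
  rw [hd, hv.deriv] at h2
  simp at h2
  exact ha.ne' h2

lemma clippedField_pos_of_ge {ε lam b t x : ℝ} (hε : 0 < ε) (hb : 0 < b)
    (hb3 : 1 < b ^ 3 - lam * b) (hx : b ≤ x) : 0 < clippedField ε lam b t x := by
  rw [clippedField, min_eq_left hx, max_eq_right (by linarith)]
  have := neg_one_le_cos t
  exact div_pos (by linarith) (by positivity)

/-- A solution which is below `b` and later reaches `b` stays above `b` forever. -/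
lemma IsSecondOrderSol.lt_of_reached {ε lam b : ℝ} (hε : 0 < ε) (hb : 0 < b)
    (hb3 : 1 < b ^ 3 - lam * b) {u v : ℝ → ℝ}
    (h : IsSecondOrderSol (clippedField ε lam b) u v) {s t₀ t : ℝ} (hs : s ≤ t₀) (ht : t₀ < t)
    (hus : u s < b) (hu₀ : b ≤ u t₀) : b < u t := by
  by_contra! hut
  have hst : s < t₀ := lt_of_le_of_ne hs (by rintro rfl; linarith)
  obtain ⟨r, hr, hmax⟩ := isCompact_Icc.exists_isMaxOn (nonempty_Icc.2 (hst.trans ht).le)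
    h.continuous.continuousOn
  have hloc : ∀ r ∈ Ioo s t, IsMaxOn u (Icc s t) r → b ≤ u r → False := fun r hr hm hbr =>
    not_isLocalMax_of_accel_pos (fun t => (h t).1) (h r).2
      (clippedField_pos_of_ge hε hb hb3 hbr) (hm.isLocalMax (Icc_mem_nhds hr.1 hr.2))
  have h0 : u t₀ ≤ u r := hmax ⟨hs, ht.le⟩
  rcases hr.1.eq_or_lt with rfl | hr1
  · linarith
  rcases hr.2.eq_or_lt with rfl | hr2
  · exact hloc t₀ ⟨hst, ht⟩ (fun y hy => (hmax hy).trans (hut.trans hu₀)) hu₀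
  · exact hloc r ⟨hr1, hr2⟩ hmax (hu₀.trans h0)

/-- A rising spike: a solution of the clipped Duffing equation on `[0, T]` which starts at rest
and increases up to the level `b`. -/
structure IsSpike (ε lam b T : ℝ) (w w' : ℝ → ℝ) : Prop where
  T_pos : 0 < T
  T_lt : T < π / 2
  hasDerivAt : ∀ t, HasDerivAt w (w' t) t
  continuous_velocity : Continuous w'
  hasDerivAt_velocity : ∀ t ∈ Icc 0 T, HasDerivAt w' (clippedField ε lam b t (w t)) t
  velocity_zero : w' 0 = 0
  velocity_pos : ∀ t ∈ Ioc 0 T, 0 < w' t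
  apply_T : w T = b

lemma IsSpike.strictMonoOn {ε lam b T : ℝ} {w w' : ℝ → ℝ} (h : IsSpike ε lam b T w w') :
    StrictMonoOn w (Icc 0 T) := by
  refine strictMonoOn_of_deriv_pos (convex_Icc _ _)
    (fun t _ => (h.hasDerivAt t).continuousAt.continuousWithinAt) fun t ht => ?_
  rw [interior_Icc] at ht
  rw [(h.hasDerivAt t).deriv]
  exact h.velocity_pos t ⟨ht.1, ht.2.le⟩

lemma IsSpike.velocity_nonneg {ε lam b T : ℝ} {w w' : ℝ → ℝ} (h : IsSpike ε lam b T w w')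
    {t : ℝ} (ht : t ∈ Icc 0 T) : 0 ≤ w' t := by
  rcases ht.1.eq_or_lt with rfl | h0
  · exact h.velocity_zero.ge
  · exact (h.velocity_pos t ⟨h0, ht.2⟩).le

lemma StrictMonoOn.exists_continuous_inverse {w : ℝ → ℝ} {a c : ℝ} (hac : a ≤ c)
    (hm : StrictMonoOn w (Icc a c)) (hw : ContinuousOn w (Icc a c)) :
    ∃ g : ℝ → ℝ, Continuous g ∧ (∀ z, g z ∈ Icc a c) ∧ (∀ t ∈ Icc a c, g (w t) = t) ∧
      ∀ z ∈ Icc (w a) (w c), w (g z) = z := by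
  have hwac : w a ≤ w c := hm.monotoneOn ⟨le_rfl, hac⟩ ⟨hac, le_rfl⟩ hac
  have hmaps : ∀ t : Icc a c, w t ∈ Icc (w a) (w c) := fun t =>
    ⟨hm.monotoneOn ⟨le_rfl, hac⟩ t.2 t.2.1, hm.monotoneOn t.2 ⟨hac, le_rfl⟩ t.2.2⟩
  let f : Icc a c → Icc (w a) (w c) := fun t => ⟨w t, hmaps t⟩
  have hf : StrictMono f := fun s t hst => hm s.2 t.2 hst
  have hsurj : Function.Surjective f := fun z => by
    obtain ⟨t, ht, htz⟩ := intermediate_value_Icc hac hw z.2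
    exact ⟨⟨t, ht⟩, Subtype.ext htz⟩
  let e := hf.orderIsoOfSurjective f hsurj
  have he : ∀ t, e t = f t := fun t => rfl
  refine ⟨fun z => (IccExtend hwac (fun y => (e.symm y)) z : Icc a c), ?_,
    fun z => Subtype.coe_prop _, fun t ht => ?_, fun z hz => ?_⟩
  · exact continuous_subtype_val.comp e.symm.continuous.Icc_extend'
  · beta_reduce
    rw [IccExtend_of_mem _ _ (hmaps ⟨t, ht⟩)]
    have : e.symm (f ⟨t, ht⟩) = ⟨t, ht⟩ := by rw [← he, e.symm_apply_apply]
    exact congrArg Subtype.val this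
  · beta_reduce
    rw [IccExtend_of_mem _ _ hz]
    have : f (e.symm ⟨z, hz⟩) = ⟨z, hz⟩ := by rw [← he, e.apply_symm_apply]
    exact congrArg Subtype.val this

/-- A solution which meets the spike with at least its slope rises to the level `b` before
time `T`. -/
lemma IsSpike.exists_ge_of_slope_le {ε lam b T : ℝ} {w w' : ℝ → ℝ}
    (h : IsSpike ε lam b T w w') (hb : 0 < b) {x y : ℝ → ℝ}
    (hx : IsSecondOrderSol (clippedField ε lam b) x y) {t₁ : ℝ} (ht₁ : t₁ ∈ Icc 0 T)
    (hxw : x t₁ = w t₁) (hyw : w' t₁ ≤ y t₁) : ∃ t ∈ Icc t₁ T, b ≤ x t := by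
  rcases hyw.eq_or_lt with hyw | hyw
  · obtain ⟨K, hK⟩ := exists_lipschitzWith_clippedField ε lam hb
    have hsol : ∀ t ∈ Icc t₁ T, HasDerivAt (fun s => (w s, w' s))
        (phaseField (clippedField ε lam b) t (w t, w' t)) t := fun t ht =>
      (h.hasDerivAt t).prodMk (h.hasDerivAt_velocity t ⟨ht₁.1.trans ht.1, ht.2⟩)
    have := ODE_solution_unique (v := phaseField (clippedField ε lam b)) (a := t₁) (b := T)
      (lipschitzWith_phaseField hK)
      (fun t ht => (hsol t ht).continuousAt.continuousWithinAt)
      (fun t ht => (hsol t (Ico_subset_Icc_self ht)).hasDerivWithinAt)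
      (fun t _ => (hx.hasDerivAt_pair t).continuousAt.continuousWithinAt)
      (fun t _ => (hx.hasDerivAt_pair t).hasDerivWithinAt)
      (by simp [hxw, hyw]) (right_mem_Icc.2 ht₁.2)
    have h2 : w T = x T := congrArg Prod.fst this
    exact ⟨T, right_mem_Icc.2 ht₁.2, by rw [← h2, h.apply_T]⟩
  by_contra! hlt
  have hm := h.strictMonoOn
  obtain ⟨g, hgc, hgm, hgw, hwg⟩ := hm.exists_continuous_inverse h.T_pos.le
    (fun t _ => (h.hasDerivAt t).continuousAt.continuousWithinAt)
  rw [h.apply_T] at hwg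
  have hw0 : w 0 ≤ w t₁ := hm.monotoneOn ⟨le_rfl, h.T_pos.le⟩ ht₁ ht₁.1
  have hxc := hx.continuous
  have hyc := hx.continuous_velocity
  have hw'c := h.continuous_velocity
  set P : ℝ → ℝ := fun t => y t ^ 2 - w' (g (x t)) ^ 2 with hP
  have hPc : Continuous P := by fun_prop
  have hyt₁ : 0 < y t₁ := (h.velocity_nonneg ht₁).trans_lt hyw
  have hP₁ : 0 < P t₁ := by
    have := h.velocity_nonneg ht₁
    simp only [hP, hxw, hgw t₁ ht₁]
    nlinarith
  have key : ∀ t₂ ∈ Icc t₁ T, (∀ t ∈ Ico t₁ t₂, 0 < P t) →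
      P t₁ ≤ P t₂ ∧ t₂ ≤ g (x t₂) ∧ w t₁ ≤ x t₂ := by
    intro t₂ ht₂ hpos
    have hypos : ∀ t ∈ Ico t₁ t₂, 0 < y t := by
      intro t ht
      by_contra! hneg
      obtain ⟨s, hs, hs0⟩ := intermediate_value_Icc' ht.1 hyc.continuousOn ⟨hneg, hyt₁.le⟩
      have := hpos s ⟨hs.1, hs.2.trans_lt ht.2⟩
      simp only [hP, hs0] at this
      nlinarith [sq_nonneg (w' (g (x s)))]
    have hxm : StrictMonoOn x (Icc t₁ t₂) := by
      refine strictMonoOn_of_deriv_pos (convex_Icc _ _) hxc.continuousOn fun t ht => ?_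
      rw [interior_Icc] at ht
      rw [(hx t).1.deriv]
      exact hypos t ⟨ht.1.le, ht.2⟩
    have hin : ∀ t ∈ Ioo t₁ t₂, w (g (x t)) = x t ∧ 0 < w' (g (x t)) ∧ w' (g (x t)) < y t ∧
        HasDerivAt (fun s => g (x s)) ((w' (g (x t)))⁻¹ * y t) t := by
      intro t ht
      have h1 : w 0 < x t := hw0.trans_lt (hxw ▸ hxm ⟨le_rfl, ht₂.1⟩ ⟨ht.1.le, ht.2.le⟩ ht.1)
      have h2 : x t < b := hlt t ⟨ht.1.le, ht.2.le.trans ht₂.2⟩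
      have h3 : w (g (x t)) = x t := hwg _ ⟨h1.le, h2.le⟩
      have h4 : 0 < g (x t) := lt_of_le_of_ne (hgm _).1 fun h0 => by
        rw [← h0] at h3; exact h1.ne h3
      have h5 : 0 < w' (g (x t)) := h.velocity_pos _ ⟨h4, (hgm _).2⟩
      have h6 := hpos t ⟨ht.1.le, ht.2⟩
      have h7 := hypos t ⟨ht.1.le, ht.2⟩
      refine ⟨h3, h5, by simp only [hP] at h6; nlinarith, ?_⟩
      have h8 : HasDerivAt g (w' (g (x t)))⁻¹ (x t) :=
        HasDerivAt.of_local_left_inverse hgc.continuousAt (h.hasDerivAt _) h5.ne'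
          (by filter_upwards [Icc_mem_nhds h1 h2] with z hz using hwg z hz)
      exact h8.comp t (hx t).1
    have hlate : ∀ t ∈ Icc t₁ t₂, t ≤ g (x t) := by
      have hmono : MonotoneOn (fun t => g (x t) - t) (Icc t₁ t₂) := by
        refine monotoneOn_of_deriv_nonneg (convex_Icc _ _)
          (Continuous.continuousOn (by fun_prop)) (fun t ht => ?_) fun t ht => ?_
        all_goals
          rw [interior_Icc] at ht
          obtain ⟨-, h2, h3, h4⟩ := hin t ht
        · exact (h4.sub (hasDerivAt_id t)).differentiableAt.differentiableWithinAt
        · rw [(h4.fun_sub (hasDerivAt_id' t)).deriv, sub_nonneg, inv_mul_eq_div, one_le_div h2]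
          exact h3.le
      intro t ht
      have := hmono ⟨le_rfl, ht₂.1⟩ ht ht.1
      simp only [hxw, hgw t₁ ht₁] at this
      linarith
    refine ⟨?_, hlate t₂ ⟨ht₂.1, le_rfl⟩,
      hxw ▸ hxm.monotoneOn ⟨le_rfl, ht₂.1⟩ ⟨ht₂.1, le_rfl⟩ ht₂.1⟩
    have hPd : ∀ t ∈ Ioo t₁ t₂,
        HasDerivAt P (2 * y t * ((cos t - cos (g (x t))) / ε ^ 2)) t := by
      intro t ht
      obtain ⟨h1, h2, -, h4⟩ := hin t ht
      have h5 := ((h.hasDerivAt_velocity _ (hgm (x t))).comp t h4).pow 2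
      have h6 := ((hx t).2.pow 2).sub h5
      refine h6.congr_deriv ?_
      have h7 : w' (g (x t)) * (w' (g (x t)))⁻¹ = 1 := mul_inv_cancel₀ h2.ne'
      simp only [Function.comp_apply, h1, clippedField]
      linear_combination (-2 * y t * ((max (-b) (min b (x t)) ^ 3 - lam * max (-b) (min b (x t)) +
        cos (g (x t))) / ε ^ 2)) * h7
    refine monotoneOn_of_deriv_nonneg (convex_Icc t₁ t₂) hPc.continuousOn (fun t ht => ?_)
      (fun t ht => ?_) ⟨le_rfl, ht₂.1⟩ ⟨ht₂.1, le_rfl⟩ ht₂.1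
    all_goals rw [interior_Icc] at ht
    · exact (hPd t ht).differentiableAt.differentiableWithinAt
    · rw [(hPd t ht).deriv]
      have h1 := hypos t ⟨ht.1.le, ht.2⟩
      have h2 : cos (g (x t)) ≤ cos t := cos_le_cos_of_nonneg_of_le_pi (ht₁.1.trans ht.1.le)
        ((hgm _).2.trans (by linarith [h.T_lt, pi_pos])) (hlate t ⟨ht.1.le, ht.2.le⟩)
      have h3 := sub_nonneg.2 h2
      positivity
  have hPpos : ∀ t ∈ Icc t₁ T, 0 < P t := by
    by_contra! hex
    have hcpt : IsCompact (Icc t₁ T ∩ {t | P t ≤ 0}) :=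
      isCompact_Icc.inter_right (isClosed_le hPc continuous_const)
    obtain ⟨t₂, ⟨ht₂, hPt₂⟩, hmin⟩ := hcpt.exists_isMinOn hex continuousOn_id
    have := (key t₂ ht₂ fun t ht => by
      by_contra! hle
      exact absurd (hmin ⟨⟨ht.1, ht.2.le.trans ht₂.2⟩, hle⟩) (not_le.2 ht.2)).1
    exact absurd (hP₁.trans_le this) (not_lt.2 hPt₂)
  have hTm : T ∈ Icc t₁ T := right_mem_Icc.2 ht₁.2
  obtain ⟨-, h2, h3⟩ := key T hTm fun t ht => hPpos t (Ico_subset_Icc_self ht)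
  have h4 := hlt T hTm
  have h5 := hwg (x T) ⟨hw0.trans h3, h4.le⟩
  rw [le_antisymm (hgm _).2 h2, h.apply_T] at h5
  linarith

/-- A solution which starts below the spike and meets it rises to the level `b`. -/
lemma IsSpike.exists_ge_of_crossing {ε lam b T : ℝ} {w w' : ℝ → ℝ}
    (h : IsSpike ε lam b T w w') (hb : 0 < b) {x y : ℝ → ℝ}
    (hx : IsSecondOrderSol (clippedField ε lam b) x y) (hx0 : x 0 < w 0) {s : ℝ}
    (hs : s ∈ Icc 0 T) (hxs : x s = w s) : ∃ t ∈ Icc 0 T, b ≤ x t := by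
  have hwc : Continuous w := continuous_iff_continuousAt.2 fun t => (h.hasDerivAt t).continuousAt
  have hcpt : IsCompact (Icc 0 T ∩ {t | w t ≤ x t}) :=
    isCompact_Icc.inter_right (isClosed_le hwc hx.continuous)
  obtain ⟨t₁, ⟨ht₁, hle⟩, hmin⟩ := hcpt.exists_isMinOn ⟨s, hs, hxs.ge⟩ continuousOn_id
  change w t₁ ≤ x t₁ at hle
  have hbefore : ∀ t ∈ Ico 0 t₁, x t < w t := fun t ht => by
    by_contra! hle
    exact absurd (hmin ⟨⟨ht.1, ht.2.le.trans ht₁.2⟩, hle⟩) (not_le.2 ht.2)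
  have hpos : 0 < t₁ := lt_of_le_of_ne ht₁.1 (by rintro rfl; linarith)
  have heq : x t₁ = w t₁ := by
    refine le_antisymm ?_ hle
    have hmem : t₁ ∈ closure (Ico 0 t₁) := by
      rw [closure_Ico hpos.ne]; exact ⟨hpos.le, le_rfl⟩
    exact closure_minimal (fun t ht => (hbefore t ht).le) (isClosed_le hx.continuous hwc) hmem
  have hslope : w' t₁ ≤ y t₁ := by
    have hd : HasDerivWithinAt (fun t => x t - w t) (y t₁ - w' t₁) (Iio t₁) t₁ :=
      ((hx t₁).1.sub (h.hasDerivAt t₁)).hasDerivWithinAt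
    rw [hasDerivWithinAt_iff_tendsto_slope' (by simp)] at hd
    have : 0 ≤ y t₁ - w' t₁ := by
      refine ge_of_tendsto hd ?_
      filter_upwards [Ioo_mem_nhdsLT hpos] with t ht
      have := hbefore t ⟨ht.1.le, ht.2⟩
      rw [slope_def_field, heq, sub_self, sub_zero]
      exact div_nonneg_of_nonpos (by linarith) (by linarith [ht.2])
    linarith
  obtain ⟨t, ht, hbt⟩ := h.exists_ge_of_slope_le hb hx ht₁ heq hslope
  exact ⟨t, ⟨ht₁.1.trans ht.1, ht.2⟩, hbt⟩

/-- Admissible constants: `α₀` is the root of `x³ - λx + 1` below the local maximum `-k` of the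
cubic, the local minimum of `x³ - λx` lies below `-1`, and `b³ - λb` exceeds `1`. -/
structure IsDuffing (ε lam b k α₀ : ℝ) : Prop where
  eps_pos : 0 < ε
  b_pos : 0 < b
  one_lt_cubic : 1 < b ^ 3 - lam * b
  k_pos : 0 < k
  lam_eq : lam = 3 * k ^ 2
  one_lt_two_mul : 1 < 2 * k ^ 3
  root : α₀ ^ 3 - lam * α₀ = -1
  root_lt : α₀ < -k

namespace IsDuffing

variable {ε lam b k α₀ : ℝ}

lemma cubic_le (h : IsDuffing ε lam b k α₀) {x y : ℝ} (hxy : x ≤ y) (hy : y ≤ -k) :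
    x ^ 3 - lam * x ≤ y ^ 3 - lam * y := by
  have hk := h.k_pos
  have h1 : k ^ 2 ≤ y ^ 2 := by nlinarith
  have h2 : k ^ 2 ≤ x * y := by nlinarith
  have h3 : k ^ 2 ≤ x ^ 2 := by nlinarith
  have h4 : 0 ≤ (y - x) * (x ^ 2 + x * y + y ^ 2 - 3 * k ^ 2) :=
    mul_nonneg (by linarith) (by linarith)
  rw [h.lam_eq]
  linarith

lemma k_lt (h : IsDuffing ε lam b k α₀) : k < b := by
  have h1 := h.one_lt_cubic
  have hb := h.b_pos
  have hk := h.k_pos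
  rw [h.lam_eq] at h1
  by_contra! hle
  have : b ^ 2 ≤ k ^ 2 := by nlinarith
  nlinarith [sq_nonneg k]

lemma neg_lt_root (h : IsDuffing ε lam b k α₀) : -b < α₀ := by
  by_contra! hle
  have h1 := h.cubic_le hle (by linarith [h.k_lt])
  have h2 := h.root
  have h3 := h.one_lt_cubic
  nlinarith

lemma field_le (h : IsDuffing ε lam b k α₀) (t : ℝ) {x : ℝ} (hx : x ≤ α₀) :
    clippedField ε lam b t x ≤ (cos t - 1) / ε ^ 2 := by
  have h1 := h.root_lt
  have h2 := h.k_pos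
  have h3 := h.k_lt
  have h4 := h.neg_lt_root
  have h5 := h.eps_pos
  rw [clippedField, min_eq_right (by linarith)]
  have h6 := h.cubic_le (max_le h4.le hx) h1.le
  rw [h.root] at h6
  gcongr
  linarith

end IsDuffing

/-- `U α` is the clipped Duffing solution starting at rest from `α`, with velocity `V α`. -/
structure IsShooting (ε lam b : ℝ) (U V : ℝ → ℝ → ℝ) : Prop where
  sol : ∀ α, IsSecondOrderSol (clippedField ε lam b) (U α) (V α)
  start : ∀ α, U α 0 = α
  rest : ∀ α, V α 0 = 0

lemma exists_isShooting (ε lam : ℝ) {b : ℝ} (hb : 0 < b) :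
    ∃ U V, IsShooting ε lam b U V := by
  obtain ⟨K, hK⟩ := exists_lipschitzWith_clippedField ε lam hb
  obtain ⟨C, hC⟩ := exists_abs_clippedField_le ε lam hb
  choose U V h using exists_secondOrderSol hK
    (fun x => by unfold clippedField; fun_prop) hC
  exact ⟨U, V, fun α => (h α).1, fun α => (h α).2.1, fun α => (h α).2.2⟩

namespace IsShooting

variable {ε lam b k α₀ abar T : ℝ} {U V : ℝ → ℝ → ℝ} {w w' : ℝ → ℝ}

lemma continuousOn (h : IsShooting ε lam b U V) (hb : 0 < b) :
    ContinuousOn (fun q : ℝ × ℝ => U q.1 q.2) {q | 0 ≤ q.2} := by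
  obtain ⟨K, hK⟩ := exists_lipschitzWith_clippedField ε lam hb
  exact continuous_secondOrderSol hK h.sol h.start h.rest

lemma continuous_param (h : IsShooting ε lam b U V) (hb : 0 < b) {t : ℝ} (ht : 0 ≤ t) :
    Continuous fun α => U α t :=
  (h.continuousOn hb).comp_continuous (f := fun α => (α, t)) (by fun_prop) fun _ => ht

/-- A trajectory of the family which leaves `(-b, b)` never returns. -/
lemma lt_of_reached (h : IsShooting ε lam b U V) (hd : IsDuffing ε lam b k α₀) {α t₀ t : ℝ}
    (hα : α ∈ Ioo (-b) b) (n : ℕ) (ht₀ : 0 ≤ t₀) (ht : t₀ < t) (hU : b ≤ (-1) ^ n * U α t₀) :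
    b < (-1) ^ n * U α t := by
  have := ((h.sol α).shift hd.b_pos n).lt_of_reached hd.eps_pos hd.b_pos hd.one_lt_cubic
    (s := -(n * π)) (t₀ := t₀ - n * π) (t := t - n * π) (by linarith) (by linarith)
    (by
      simp only [add_neg_cancel, h.start]
      rcases neg_one_pow_eq_or ℝ n with hn | hn <;> rw [hn] <;> linarith [hα.1, hα.2])
    (by simpa using hU)
  simpa using this

lemma le_of_reached (h : IsShooting ε lam b U V) (hd : IsDuffing ε lam b k α₀) {α t₀ t : ℝ}
    (hα : α ∈ Ioo (-b) b) (n : ℕ) (ht₀ : 0 ≤ t₀) (ht : t₀ ≤ t) (hU : b ≤ (-1) ^ n * U α t₀) :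
    b ≤ (-1) ^ n * U α t := by
  rcases ht.eq_or_lt with rfl | ht
  · exact hU
  · exact (h.lt_of_reached hd hα n ht₀ ht hU).le

lemma le_neg_of_reached (h : IsShooting ε lam b U V) (hd : IsDuffing ε lam b k α₀) {α t₀ t : ℝ}
    (hα : α ∈ Ioo (-b) b) (n : ℕ) (ht₀ : 0 ≤ t₀) (ht : t₀ ≤ t) (hU : (-1) ^ n * U α t₀ ≤ -b) :
    (-1) ^ n * U α t ≤ -b := by
  have := h.le_of_reached hd hα (n + 1) ht₀ ht (by rw [pow_succ]; linarith)
  rw [pow_succ] at this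
  linarith

lemma root_le_root (h : IsShooting ε lam b U V) (hd : IsDuffing ε lam b k α₀) {t : ℝ}
    (ht : 0 ≤ t) : U α₀ t ≤ α₀ := by
  have hlt : ∀ α < α₀, U α t ≤ α₀ := by
    intro α hα
    by_contra! hgt
    have hcpt : IsCompact (Icc 0 t ∩ {s | α₀ ≤ U α s}) :=
      isCompact_Icc.inter_right (isClosed_le continuous_const (h.sol α).continuous)
    obtain ⟨t₁, ⟨ht₁, hle⟩, hmin⟩ := hcpt.exists_isMinOn ⟨t, ⟨ht, le_rfl⟩, hgt.le⟩ continuousOn_id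
    change α₀ ≤ U α t₁ at hle
    have hbefore : ∀ s ∈ Ioo 0 t₁, U α s ≤ α₀ := fun s hs => by
      by_contra! hle
      exact absurd (hmin ⟨⟨hs.1.le, hs.2.le.trans ht₁.2⟩, hle.le⟩) (not_le.2 hs.2)
    have hV : AntitoneOn (V α) (Icc 0 t₁) := by
      refine antitoneOn_of_deriv_nonpos (convex_Icc _ _) (h.sol α).continuous_velocity.continuousOn
        (fun s _ => (h.sol α s).2.differentiableAt.differentiableWithinAt) fun s hs => ?_
      rw [interior_Icc] at hs
      rw [(h.sol α s).2.deriv]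
      exact (hd.field_le s (hbefore s hs)).trans
        (div_nonpos_of_nonpos_of_nonneg (by linarith [cos_le_one s]) (sq_nonneg ε))
    have hU : AntitoneOn (U α) (Icc 0 t₁) := by
      refine antitoneOn_of_deriv_nonpos (convex_Icc _ _) (h.sol α).continuous.continuousOn
        (fun s _ => (h.sol α s).1.differentiableAt.differentiableWithinAt) fun s hs => ?_
      rw [interior_Icc] at hs
      rw [(h.sol α s).1.deriv, ← h.rest α]
      exact hV ⟨le_rfl, ht₁.1⟩ ⟨hs.1.le, hs.2.le⟩ hs.1.le
    have := hU ⟨le_rfl, ht₁.1⟩ ⟨ht₁.1, le_rfl⟩ ht₁.1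
    rw [h.start] at this
    linarith
  have hcl : IsClosed {α | U α t ≤ α₀} :=
    isClosed_le (h.continuous_param hd.b_pos ht) continuous_const
  have hmem : α₀ ∈ closure (Iio α₀) := by simp
  exact closure_minimal hlt hcl hmem

lemma root_exits (h : IsShooting ε lam b U V) (hd : IsDuffing ε lam b k α₀) :
    ∃ t, 0 ≤ t ∧ U α₀ t ≤ -b := by
  have hε := hd.eps_pos
  have hb := hd.b_pos
  have hd1 : ∀ s, HasDerivAt (fun s => V α₀ s - (sin s - s) / ε ^ 2)
      (clippedField ε lam b s (U α₀ s) - (cos s - 1) / ε ^ 2) s := fun s =>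
    (h.sol α₀ s).2.sub (((hasDerivAt_sin s).sub (hasDerivAt_id' s)).div_const _)
  have hd2 : ∀ s, HasDerivAt (fun s => U α₀ s - (1 - cos s - s ^ 2 / 2) / ε ^ 2)
      (V α₀ s - (sin s - s) / ε ^ 2) s := fun s => by
    have h1 := (((hasDerivAt_cos s).const_sub 1).sub
      ((hasDerivAt_pow 2 s).div_const 2)).div_const (ε ^ 2)
    refine ((h.sol α₀ s).1.sub h1).congr_deriv ?_
    norm_num
  have hV : AntitoneOn (fun s => V α₀ s - (sin s - s) / ε ^ 2) (Ici 0) := by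
    refine antitoneOn_of_deriv_nonpos (convex_Ici _)
      (fun s _ => (hd1 s).continuousAt.continuousWithinAt)
      (fun s _ => (hd1 s).differentiableAt.differentiableWithinAt) fun s hs => ?_
    rw [interior_Ici] at hs
    rw [(hd1 s).deriv, sub_nonpos]
    exact hd.field_le s (h.root_le_root hd hs.le)
  have hU : AntitoneOn (fun s => U α₀ s - (1 - cos s - s ^ 2 / 2) / ε ^ 2) (Ici 0) := by
    refine antitoneOn_of_deriv_nonpos (convex_Ici _)
      (fun s _ => (hd2 s).continuousAt.continuousWithinAt)
      (fun s _ => (hd2 s).differentiableAt.differentiableWithinAt) fun s hs => ?_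
    rw [interior_Ici] at hs
    rw [(hd2 s).deriv]
    have := hV (mem_Ici.2 le_rfl) (mem_Ici.2 hs.le) hs.le
    simpa [h.rest] using this
  have hs : (0 : ℝ) ≤ 2 + ε ^ 2 * b := by positivity
  refine ⟨2 + ε ^ 2 * b, hs, ?_⟩
  have h1 := hU (mem_Ici.2 le_rfl) (mem_Ici.2 hs) hs
  have h2 : (1 - cos (2 + ε ^ 2 * b) - (2 + ε ^ 2 * b) ^ 2 / 2) / ε ^ 2 ≤ -2 * b := by
    rw [div_le_iff₀ (by positivity)]
    nlinarith [neg_one_le_cos (2 + ε ^ 2 * b), sq_nonneg (ε ^ 2 * b)]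
  simp only [h.start, cos_zero] at h1
  norm_num at h1
  linarith [hd.root_lt, hd.k_pos]

/-- A trajectory at the base level of the spike at time `nπ` has left `(-b, b)` by `nπ + T`. -/
lemma le_of_gate (h : IsShooting ε lam b U V) (hd : IsDuffing ε lam b k α₀)
    (hw : IsSpike ε lam b T w w') {α t : ℝ} (hα : α ∈ Ioo (-b) b) (n : ℕ)
    (hgate : (-1) ^ n * U α (n * π) = w 0) (ht : n * π + T ≤ t) : b ≤ (-1) ^ n * U α t := by
  have hx := (h.sol α).shift hd.b_pos n
  have hT := hw.T_pos
  have hT2 := hw.T_lt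
  have hn : 0 ≤ (n : ℝ) * π := by positivity
  have h0 : (0 : ℝ) ∈ Icc 0 T := ⟨le_rfl, hT.le⟩
  rcases le_or_gt 0 ((-1) ^ n * V α (n * π + 0)) with hv | hv
  · obtain ⟨s, hs, hbs⟩ := hw.exists_ge_of_slope_le hd.b_pos hx h0 (by simpa using hgate)
      (by rw [hw.velocity_zero]; exact hv)
    exact h.le_of_reached hd hα n (by linarith [hs.1]) (by linarith [hs.2]) hbs
  · have hn0 : n ≠ 0 := by rintro rfl; simp [h.rest] at hv
    have hn1 : (1 : ℝ) ≤ n := by exact_mod_cast Nat.one_le_iff_ne_zero.2 hn0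
    obtain ⟨s, hs, hbs⟩ := hw.exists_ge_of_slope_le hd.b_pos hx.reflect h0 (by simpa using hgate)
      (by rw [hw.velocity_zero]; simp only [neg_zero]; linarith)
    have h1 := h.le_of_reached hd hα n (t := n * π) (by nlinarith [hs.2, pi_pos])
      (by linarith [hs.1]) hbs
    have h2 := hw.strictMonoOn h0 ⟨hT.le, le_rfl⟩ hT
    rw [hw.apply_T] at h2
    linarith

end IsShooting

lemma eq_of_mem_uIcc_of_abs_le {p r x : ℝ} (hx : x ∈ uIcc p r) (h : |r - p| ≤ |x - p|) :
    x = r := by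
  rcases mem_uIcc.1 hx with ⟨h1, h2⟩ | ⟨h1, h2⟩
  · rw [abs_of_nonneg (by linarith), abs_of_nonneg (by linarith)] at h
    linarith
  · rw [abs_of_nonpos (by linarith), abs_of_nonpos (by linarith)] at h
    linarith

/-- A nonempty compact set has a point which is the first one met when starting from `p`. -/
lemma IsCompact.exists_first_mem {K : Set ℝ} (hK : IsCompact K) (hne : K.Nonempty) (p : ℝ) :
    ∃ r ∈ K, ∀ x ∈ uIcc p r, x ∈ K → x = r := by
  obtain ⟨r, hr, hmin⟩ := hK.exists_isMinOn hne (f := fun x => |x - p|)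
    (Continuous.continuousOn (by fun_prop))
  exact ⟨r, hr, fun x hx hxK => eq_of_mem_uIcc_of_abs_le hx (hmin hxK)⟩

/-- A continuous path from below `hi` to above `hi` contains a stretch which stays in `[lo, hi]`,
ends at level `hi`, and begins either at the start of the path or at level `lo`. -/
lemma exists_uIcc_band {f : ℝ → ℝ} (hf : Continuous f) {p q lo hi : ℝ} (hlo : lo < hi)
    (hp : f p < hi) (hq : hi ≤ f q) :
    ∃ p' r, uIcc p' r ⊆ uIcc p q ∧ f r = hi ∧ (∀ x ∈ uIcc p' r, f x ∈ Icc lo hi) ∧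
      (p' = p ∨ f p' = lo) := by
  obtain ⟨r, ⟨hrm, hrf⟩, hr⟩ := (isCompact_uIcc.inter_right (isClosed_le continuous_const hf)
    : IsCompact (uIcc p q ∩ {x | hi ≤ f x})).exists_first_mem ⟨q, right_mem_uIcc, hq⟩ p
  have hsub : uIcc p r ⊆ uIcc p q := uIcc_subset_uIcc left_mem_uIcc hrm
  have hfr : f r = hi := by
    obtain ⟨x, hx, hfx⟩ := intermediate_value_uIcc hf.continuousOn (mem_uIcc_of_le hp.le hrf)
    rw [← hr x hx ⟨hsub hx, hfx.ge⟩, hfx]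
  have hle : ∀ x ∈ uIcc p r, f x ≤ hi := fun x hx => by
    by_contra! hgt
    rw [hr x hx ⟨hsub hx, hgt.le⟩, hfr] at hgt
    exact hgt.false
  rcases (uIcc p r ∩ {x | f x ≤ lo}).eq_empty_or_nonempty with hem | hne
  · refine ⟨p, r, hsub, hfr, fun x hx => ⟨?_, hle x hx⟩, Or.inl rfl⟩
    by_contra! hlt
    exact (hem ▸ ⟨hx, hlt.le⟩ : x ∈ (∅ : Set ℝ))
  · obtain ⟨p', ⟨hpm, hpf⟩, hp'⟩ := (isCompact_uIcc.inter_right (isClosed_le hf continuous_const)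
      : IsCompact (uIcc p r ∩ {x | f x ≤ lo})).exists_first_mem hne r
    have hsub' : uIcc r p' ⊆ uIcc p r := uIcc_subset_uIcc right_mem_uIcc hpm
    have hfp : f p' = lo := by
      obtain ⟨x, hx, hfx⟩ := intermediate_value_uIcc (a := r) (b := p') hf.continuousOn
        (mem_uIcc_of_ge hpf (by rw [hfr]; exact hlo.le))
      rw [← hp' x hx ⟨hsub' hx, hfx.le⟩, hfx]
    rw [uIcc_comm] at hsub'
    refine ⟨p', r, hsub'.trans hsub, hfr, fun x hx => ⟨?_, hle x (hsub' hx)⟩, Or.inr hfp⟩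
    by_contra! hlt
    rw [hp' x (by rwa [uIcc_comm]) ⟨hsub' hx, hlt.le⟩, hfp] at hlt
    exact hlt.false

/-- Up to half-period `N`, the sign-normalised trajectory `U` is in `[-b, abar]` at the times `jπ`
with `j ∉ S`, and above `k` at the times `jπ` with `j ∈ S`. -/
def Follows (b k abar : ℝ) (S : Set ℕ) (u : ℝ → ℝ) (N : ℕ) : Prop :=
  ∀ j ≤ N, (j ∉ S → (-1) ^ j * u (j * π) ∈ Icc (-b) abar) ∧
    (j ∈ S → k ≤ (-1) ^ j * u (j * π))

lemma Follows.mono {b k abar : ℝ} {S : Set ℕ} {u : ℝ → ℝ} {M N : ℕ}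
    (h : Follows b k abar S u N) (hMN : M ≤ N) : Follows b k abar S u M :=
  fun j hj => h j (hj.trans hMN)

/-- An interval of initial positions following `S` up to half-period `n`, one of whose endpoints
`q` is at the base of the spike while the other, `p`, stays low forever. -/
structure IsStage (b k α₀ abar : ℝ) (S : Set ℕ) (U : ℝ → ℝ → ℝ) (n : ℕ) (p q : ℝ) : Prop where
  subset : uIcc p q ⊆ Icc α₀ abar
  follows : ∀ α ∈ uIcc p q, Follows b k abar S (U α) n
  gate : (-1) ^ n * U q (n * π) = abar
  low : ∀ t, n * π ≤ t → (-1) ^ n * U p t ≤ α₀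

namespace IsStage

variable {ε lam b k α₀ abar T : ℝ} {U V : ℝ → ℝ → ℝ} {w w' : ℝ → ℝ} {S : Set ℕ} {n : ℕ} {p q : ℝ}

lemma mem_Ioo (h : IsStage b k α₀ abar S U n p q) (hd : IsDuffing ε lam b k α₀)
    (habar : abar < -k) {α : ℝ} (hα : α ∈ uIcc p q) : α ∈ Ioo (-b) b :=
  ⟨hd.neg_lt_root.trans_le (h.subset hα).1,
    (h.subset hα).2.trans_lt (by linarith [hd.k_pos, hd.b_pos])⟩

/-- Extend a stage by one half-period not in `S`. -/
lemma succ (h : IsStage b k α₀ abar S U n p q) (hd : IsDuffing ε lam b k α₀)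
    (hU : IsShooting ε lam b U V) (hw : IsSpike ε lam b T w w') (hw0 : w 0 = abar)
    (habar₀ : α₀ < abar) (habar : abar < -k) (hn : n + 1 ∉ S) :
    ∃ p' q', IsStage b k α₀ abar S U (n + 1) p' q' := by
  have hk := hd.k_pos
  have hkb := hd.k_lt
  have hnb := hd.neg_lt_root
  have hT : T < π := by linarith [hw.T_lt, pi_pos]
  have ht : (0 : ℝ) ≤ ((n + 1 : ℕ) : ℝ) * π := by positivity
  set f : ℝ → ℝ := fun α => (-1) ^ (n + 1) * U α ((n + 1 : ℕ) * π) with hf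
  have hfc : Continuous f := continuous_const.mul (hU.continuous_param hd.b_pos ht)
  have hfq : f q ≤ -b := by
    have := hU.le_of_gate hd hw (h.mem_Ioo hd habar right_mem_uIcc) n (h.gate.trans hw0.symm)
      (t := (n + 1 : ℕ) * π) (by push_cast; linarith)
    simp only [hf, pow_succ]
    linarith
  have hfp : abar ≤ f p := by
    have := h.low ((n + 1 : ℕ) * π) (by push_cast; linarith [pi_pos])
    simp only [hf, pow_succ]
    linarith [hd.root_lt]
  obtain ⟨p', r, hsub, hr, hband, hp'⟩ :=
    exists_uIcc_band hfc (lo := -b) (hi := abar) (by linarith) (hfq.trans_lt (by linarith)) hfp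
  rw [uIcc_comm q p] at hsub
  refine ⟨p', r, hsub.trans h.subset, fun α hα j hj => ?_, hr, fun t ht' => ?_⟩
  · rcases Nat.le_succ_iff.1 hj with hj | rfl
    · exact h.follows α (hsub hα) j hj
    · exact ⟨fun _ => hband α hα, fun hS => absurd hS hn⟩
  · have hfp' : f p' ≤ -b := by
      rcases hp' with rfl | hp'
      · exact hfq
      · exact hp'.le
    exact (hU.le_neg_of_reached hd (h.mem_Ioo hd habar (hsub left_mem_uIcc)) (n + 1) ht ht'
      hfp').trans hnb.le

/-- Extend a stage by a half-period in `S` followed by one not in `S`. -/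
lemma succ_succ (h : IsStage b k α₀ abar S U n p q) (hd : IsDuffing ε lam b k α₀)
    (hU : IsShooting ε lam b U V) (hw : IsSpike ε lam b T w w') (hw0 : w 0 = abar)
    (habar₀ : α₀ < abar) (habar : abar < -k) (hnS : n ∉ S) (hn₁ : n + 1 ∈ S) (hn₂ : n + 2 ∉ S) :
    ∃ p' q', IsStage b k α₀ abar S U (n + 2) p' q' := by
  have hk := hd.k_pos
  have hkb := hd.k_lt
  have hnb := hd.neg_lt_root
  have hpi := pi_pos
  have hT : T < π := by linarith [hw.T_lt]
  have hn0 : (0 : ℝ) ≤ n * π := by positivity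
  have hn2 : (0 : ℝ) ≤ ((n + 2 : ℕ) : ℝ) * π := by positivity
  have hcast1 : ((n + 1 : ℕ) : ℝ) * π = n * π + π := by push_cast; ring
  have hcast2 : ((n + 2 : ℕ) : ℝ) * π = n * π + 2 * π := by push_cast; ring
  have hpow : ((-1 : ℝ)) ^ (n + 2) = (-1) ^ n := by rw [pow_add]; simp
  set C : Set ℝ := Icc (n * π) (n * π + 2 * π) with hC
  set K : Set ℝ := image Prod.fst ((uIcc p q ×ˢ C) ∩ {z | -k ≤ (-1) ^ n * U z.1 z.2}) with hK
  have hKmem : ∀ α, α ∈ K ↔ α ∈ uIcc p q ∧ ∃ t ∈ C, -k ≤ (-1) ^ n * U α t := by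
    intro α
    constructor
    · rintro ⟨⟨β, t⟩, ⟨⟨h1, h2⟩, h3⟩, rfl⟩
      exact ⟨h1, t, h2, h3⟩
    · rintro ⟨h1, t, h2, h3⟩
      exact ⟨(α, t), ⟨⟨h1, h2⟩, h3⟩, rfl⟩
  have hKcpt : IsCompact K := by
    refine IsCompact.image ?_ continuous_fst
    have hc : ContinuousOn (fun z : ℝ × ℝ => (-1) ^ n * U z.1 z.2) (uIcc p q ×ˢ C) :=
      continuousOn_const.mul ((hU.continuousOn hd.b_pos).mono fun z hz => hn0.trans hz.2.1)
    have hcpt : IsCompact (uIcc p q ×ˢ C) := isCompact_uIcc.prod isCompact_Icc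
    exact hcpt.of_isClosed_subset
      (hc.preimage_isClosed_of_isClosed hcpt.isClosed isClosed_Ici) inter_subset_left
  have hqK : q ∈ K := by
    refine (hKmem q).2 ⟨right_mem_uIcc, n * π + π, ⟨by linarith, by linarith⟩, ?_⟩
    have := hU.le_of_gate hd hw (h.mem_Ioo hd habar right_mem_uIcc) n (h.gate.trans hw0.symm)
      (t := n * π + π) (by linarith)
    linarith
  obtain ⟨r, hrK, hr⟩ := hKcpt.exists_first_mem ⟨q, hqK⟩ p
  obtain ⟨hrm, t₀, ht₀, hrt₀⟩ := (hKmem r).1 hrK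
  have hsub : uIcc p r ⊆ uIcc p q := uIcc_subset_uIcc left_mem_uIcc hrm
  have hbelow : ∀ t ∈ C, (-1) ^ n * U r t ≤ -k := by
    intro t ht
    by_contra! hgt
    have hp := h.low t ht.1
    obtain ⟨x, hx, hfx⟩ := intermediate_value_uIcc (a := p) (b := r)
      (f := fun α => (-1) ^ n * U α t)
      (continuous_const.mul (hU.continuous_param hd.b_pos (hn0.trans ht.1))).continuousOn
      (mem_uIcc_of_le (by linarith [hd.root_lt]) hgt.le)
    have := hr x hx ((hKmem x).2 ⟨hsub hx, t, ht, hfx.ge⟩)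
    rw [← this] at hgt
    exact hgt.ne' hfx
  have hrt₀ : (-1) ^ n * U r t₀ = -k := le_antisymm (hbelow t₀ ht₀) hrt₀
  have ht₀l : t₀ ≠ n * π := by
    rintro rfl
    have := ((h.follows r hrm n le_rfl).1 hnS).2
    linarith
  have ht₀r : t₀ = n * π + 2 * π := by
    by_contra hne
    have hs : t₀ - n * π ∈ Ioo 0 (2 * π) := by
      have h1 := lt_of_le_of_ne ht₀.1 (Ne.symm ht₀l)
      have h2 := lt_of_le_of_ne ht₀.2 hne
      exact ⟨by linarith, by linarith⟩
    have hx := (hU.sol r).shift hd.b_pos n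
    refine not_isLocalMax_of_accel_pos (fun t => (hx t).1) (hx (t₀ - n * π)).2 ?_ ?_
    · simp only [add_sub_cancel, hrt₀]
      rw [clippedField_of_mem ⟨by linarith, by linarith⟩, hd.lam_eq]
      have h1 := neg_one_le_cos (t₀ - n * π)
      have h2 := hd.one_lt_two_mul
      exact div_pos (by nlinarith) (pow_pos hd.eps_pos 2)
    · filter_upwards [Icc_mem_nhds hs.1 hs.2] with s hs'
      simp only [add_sub_cancel, hrt₀]
      exact hbelow _ ⟨by linarith [hs'.1], by linarith [hs'.2]⟩
  set f : ℝ → ℝ := fun α => (-1) ^ (n + 2) * U α ((n + 2 : ℕ) * π) with hf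
  have hfc : Continuous f := continuous_const.mul (hU.continuous_param hd.b_pos hn2)
  have hfr : f r = -k := by simp only [hf, hpow, hcast2, ← ht₀r, hrt₀]
  have hlow : ∀ t, (n + 2 : ℕ) * π ≤ t → (-1) ^ (n + 2) * U p t ≤ α₀ := fun t ht => by
    rw [hpow]
    exact h.low t (by linarith)
  have hfp : f p ≤ α₀ := hlow _ le_rfl
  obtain ⟨p', r', hsub', hr', hband, hp'⟩ := exists_uIcc_band hfc (lo := -b) (hi := abar)
    (by linarith) (hfp.trans_lt habar₀) (habar.le.trans hfr.ge)
  refine ⟨p', r', (hsub'.trans hsub).trans h.subset, fun α hα j hj => ?_, hr', fun t ht => ?_⟩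
  · rcases Nat.le_succ_iff.1 hj with hj | rfl
    · rcases Nat.le_succ_iff.1 hj with hj | rfl
      · exact h.follows α (hsub (hsub' hα)) j hj
      · refine ⟨fun hS => absurd hn₁ hS, fun _ => ?_⟩
        by_contra! hlt
        have hαK : α ∈ K := by
          refine (hKmem α).2 ⟨hsub (hsub' hα), (n + 1 : ℕ) * π, ⟨by linarith, by linarith⟩, ?_⟩
          rw [pow_succ] at hlt
          linarith
        have h1 := (hband α hα).2
        rw [hr α (hsub' hα) hαK, hfr] at h1
        linarith
    · exact ⟨fun _ => hband α hα, fun hS => absurd hS hn₂⟩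
  · rcases hp' with rfl | hp'
    · exact hlow t ht
    · exact (hU.le_neg_of_reached hd (h.mem_Ioo hd habar (hsub (hsub' left_mem_uIcc))) (n + 2)
        hn2 ht hp'.le).trans hnb.le

/-- Every half-period outside `S` is the last one of some stage. -/
lemma exists_of_notMem (hd : IsDuffing ε lam b k α₀)
    (hU : IsShooting ε lam b U V) (hw : IsSpike ε lam b T w w') (hw0 : w 0 = abar)
    (habar₀ : α₀ < abar) (habar : abar < -k) (hS0 : 0 ∉ S)
    (hSgap : ∀ j : ℕ, ¬(j ∈ S ∧ j + 1 ∈ S)) (N : ℕ) :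
    N ∉ S → ∃ p q, IsStage b k α₀ abar S U N p q := by
  induction N using Nat.strong_induction_on with
  | _ N ih =>
    intro hN
    rcases N with _ | N
    · refine ⟨α₀, abar, by rw [uIcc_of_le habar₀.le], fun α hα j hj => ?_, by simp [hU.start],
        fun t ht => by simpa using hU.root_le_root hd (by simpa using ht)⟩
      rw [uIcc_of_le habar₀.le] at hα
      obtain rfl : j = 0 := Nat.le_zero.1 hj
      refine ⟨fun _ => ?_, fun hS => absurd hS hS0⟩
      simpa [hU.start] using And.intro (hd.neg_lt_root.le.trans hα.1) hα.2
    · by_cases hNS : N ∈ S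
      · rcases N with _ | N
        · exact absurd hNS hS0
        · have hNS' : N ∉ S := fun h => hSgap N ⟨h, hNS⟩
          obtain ⟨p, q, h⟩ := ih N (by omega) hNS'
          exact h.succ_succ hd hU hw hw0 habar₀ habar hNS' hNS hN
      · obtain ⟨p, q, h⟩ := ih N (by omega) hNS
        exact h.succ hd hU hw hw0 habar₀ habar hN

end IsStage

namespace IsShooting

variable {ε lam b k α₀ abar T : ℝ} {U V : ℝ → ℝ → ℝ} {w w' : ℝ → ℝ} {S : Set ℕ}

lemma exists_follows (hU : IsShooting ε lam b U V) (hd : IsDuffing ε lam b k α₀)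
    (hw : IsSpike ε lam b T w w') (hw0 : w 0 = abar) (habar₀ : α₀ < abar) (habar : abar < -k)
    (hS0 : 0 ∉ S) (hSgap : ∀ j : ℕ, ¬(j ∈ S ∧ j + 1 ∈ S)) :
    ∃ α ∈ Icc α₀ abar, ∀ N, Follows b k abar S (U α) N := by
  have hcl : ∀ N, IsClosed (Icc α₀ abar ∩ {α | Follows b k abar S (U α) N}) := by
    intro N
    have hc : ∀ j : ℕ, Continuous fun α => (-1) ^ j * U α (j * π) := fun j =>
      continuous_const.mul (hU.continuous_param hd.b_pos (by positivity))
    refine isClosed_Icc.inter ?_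
    simp only [Follows, ofPred_forall, ofPred_and]
    refine isClosed_iInter fun j => isClosed_iInter fun _ => IsClosed.inter ?_ ?_
    · exact isClosed_iInter fun _ => isClosed_Icc.preimage (hc j)
    · exact isClosed_iInter fun _ => isClosed_le continuous_const (hc j)
  have hne : ∀ N, (Icc α₀ abar ∩ {α | Follows b k abar S (U α) N}).Nonempty := by
    intro N
    obtain ⟨M, hNM, hM⟩ : ∃ M, N ≤ M ∧ M ∉ S := by
      by_cases hN : N ∈ S
      · exact ⟨N + 1, N.le_succ, fun h => hSgap N ⟨hN, h⟩⟩
      · exact ⟨N, le_rfl, hN⟩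
    obtain ⟨p, q, h⟩ := IsStage.exists_of_notMem hd hU hw hw0 habar₀ habar hS0 hSgap M hM
    exact ⟨p, h.subset left_mem_uIcc, (h.follows p left_mem_uIcc).mono hNM⟩
  obtain ⟨α, hα⟩ := IsCompact.nonempty_iInter_of_sequence_nonempty_isCompact_isClosed
    (fun N => Icc α₀ abar ∩ {α | Follows b k abar S (U α) N})
    (fun N α hα => ⟨hα.1, hα.2.mono N.le_succ⟩) hne
    (isCompact_Icc.of_isClosed_subset (hcl 0) inter_subset_left) hcl
  rw [mem_iInter] at hα
  exact ⟨α, (hα 0).1, fun N => (hα N).2⟩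

/-- A trajectory following `S` forever never leaves `(-b, b)`. -/
lemma abs_lt_of_follows (hU : IsShooting ε lam b U V) (hd : IsDuffing ε lam b k α₀)
    (habar : abar < -k) (hSgap : ∀ j : ℕ, ¬(j ∈ S ∧ j + 1 ∈ S)) {α : ℝ} (hα : α ∈ Ioo (-b) b)
    (hF : ∀ N, Follows b k abar S (U α) N) (n : ℕ) {t : ℝ} (ht : 0 ≤ t) :
    (-1) ^ n * U α t < b := by
  by_contra! hle
  obtain ⟨m, hm⟩ := exists_nat_gt t
  obtain ⟨M, hmM, hM⟩ : ∃ M, m ≤ M ∧ M ∉ S := by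
    by_cases hm : m ∈ S
    · exact ⟨m + 1, m.le_succ, fun h => hSgap m ⟨hm, h⟩⟩
    · exact ⟨m, le_rfl, hm⟩
  have hmM' : (m : ℝ) ≤ M := by exact_mod_cast hmM
  have h1 := hU.lt_of_reached hd hα n ht (t := M * π) (by nlinarith [pi_gt_three]) hle
  obtain ⟨h2, h3⟩ := (hF M M le_rfl).1 hM
  have hk := hd.k_pos
  have hkb := hd.k_lt
  rcases neg_one_pow_eq_or ℝ n with hn | hn <;> rcases neg_one_pow_eq_or ℝ M with hM | hM <;>
    rw [hn] at h1 <;> rw [hM] at h2 h3 <;> linarith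

/-- A trajectory following `S` forever meets exactly the spikes with index in `S`. -/
lemma meets_iff_of_follows (hU : IsShooting ε lam b U V) (hd : IsDuffing ε lam b k α₀)
    (hw : IsSpike ε lam b T w w') (hw0 : w 0 = abar) (habar : abar < -k)
    (hSgap : ∀ j : ℕ, ¬(j ∈ S ∧ j + 1 ∈ S)) {α : ℝ} (hα : α ∈ Ioo (-b) b)
    (hF : ∀ N, Follows b k abar S (U α) N) {j : ℕ} (hj : 0 < j) :
    (∃ t : ℝ, |t - j * π| ≤ T ∧ U α t = (-1) ^ j * w |t - j * π|) ↔ j ∈ S := by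
  have hlt := fun n t => hU.abs_lt_of_follows hd habar hSgap hα hF n (t := t)
  have hT := hw.T_pos
  have hj1 : (1 : ℝ) ≤ j := by exact_mod_cast hj
  have hjT : T ≤ j * π := by nlinarith [pi_pos, hw.T_lt]
  have hx := (hU.sol α).shift hd.b_pos j
  have hx0 : (-1 : ℝ) ^ j * (-1) ^ j = 1 := by rw [← mul_pow]; simp
  constructor
  · rintro ⟨t, ht, hUt⟩
    by_contra hjS
    have h0 : (-1) ^ j * U α (j * π + 0) < w 0 := by
      rw [add_zero, hw0]
      refine lt_of_le_of_ne ((hF j j le_rfl).1 hjS).2 fun heq => ?_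
      exact absurd (hU.le_of_gate hd hw hα j (heq.trans hw0.symm) le_rfl)
        (not_le.2 (hlt j _ (by linarith)))
    have hmeet : (-1) ^ j * U α (j * π + (t - j * π)) = w |t - j * π| := by
      rw [add_sub_cancel, hUt, ← mul_assoc, hx0, one_mul]
    rcases le_total 0 (t - j * π) with hs | hs
    · rw [abs_of_nonneg hs] at ht hmeet
      obtain ⟨s, hs, hbs⟩ := hw.exists_ge_of_crossing hd.b_pos hx h0 ⟨hs, ht⟩ hmeet
      exact absurd hbs (not_le.2 (hlt j _ (by linarith [hs.1])))
    · rw [abs_of_nonpos hs] at ht hmeet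
      obtain ⟨s, hs, hbs⟩ := hw.exists_ge_of_crossing hd.b_pos hx.reflect (by simpa using h0)
        ⟨neg_nonneg.2 hs, ht⟩ (by rw [neg_neg]; exact hmeet)
      exact absurd hbs (not_le.2 (hlt j _ (by linarith [hs.2])))
  · intro hjS
    have h0 := (hF j j le_rfl).2 hjS
    have hT' := hlt j (j * π + T) (by linarith)
    have hc : ContinuousOn (fun s => (-1) ^ j * U α (j * π + s) - w s) (Icc 0 T) :=
      hx.continuous.continuousOn.sub fun s _ => (hw.hasDerivAt s).continuousAt.continuousWithinAt
    obtain ⟨s, hs, hs0⟩ := intermediate_value_Icc' hT.le hc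
      (show (0 : ℝ) ∈ Icc _ _ from ⟨by simp only [hw.apply_T]; linarith,
        by simp only [add_zero, hw0]; linarith [hd.k_pos]⟩)
    refine ⟨j * π + s, ?_, ?_⟩
    · rw [add_sub_cancel_left, abs_of_nonneg hs.1]; exact hs.2
    · rw [add_sub_cancel_left, abs_of_nonneg hs.1, ← sub_eq_zero.1 hs0, ← mul_assoc, hx0, one_mul]

end IsShooting

lemma isDuffing_sqrt {ε lam b α₀ : ℝ} (hε : 0 < ε)
    (hlam : (3 : ℝ) / (2 : ℝ) ^ ((2 : ℝ) / 3) < lam) (hb : 0 < b) (hb3 : 1 < b ^ 3 - lam * b)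
    (hroot : α₀ ^ 3 - lam * α₀ + 1 = 0) (hα₀ : α₀ < -√(lam / 3)) :
    IsDuffing ε lam b √(lam / 3) α₀ := by
  have h2 : (0 : ℝ) < (2 : ℝ) ^ ((2 : ℝ) / 3) := by positivity
  have hlam0 : 0 < lam := lt_trans (by positivity) hlam
  have hk : 0 < √(lam / 3) := by positivity
  have hksq : √(lam / 3) ^ 2 = lam / 3 := sq_sqrt (by positivity)
  refine ⟨hε, hb, hb3, hk, by rw [hksq]; ring, ?_, by linarith, hα₀⟩
  have hcube : ((2 : ℝ) ^ ((2 : ℝ) / 3)) ^ 3 = 4 := by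
    rw [← rpow_natCast, ← rpow_mul (by norm_num)]
    norm_num
  have h3 : (27 / 4 : ℝ) < lam ^ 3 := by
    have := pow_lt_pow_left₀ hlam (by positivity) (n := 3) (by norm_num)
    rw [div_pow, hcube] at this
    norm_num at this
    exact this
  have h4 : 1 < (2 * √(lam / 3) ^ 3) ^ 2 := by
    have : (2 * √(lam / 3) ^ 3) ^ 2 = 4 * (√(lam / 3) ^ 2) ^ 3 := by ring
    rw [this, hksq]
    linarith
  nlinarith [pow_pos hk 3]

lemma isSpike_of_contDiff {ε lam b T : ℝ} {w : ℝ → ℝ} (hε : 0 < ε) (hT1 : 0 < T)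
    (hT2 : T < π / 2) (hw : ContDiff ℝ 2 w)
    (hweq : ∀ t ∈ Icc (0 : ℝ) T,
      ε ^ 2 * deriv (deriv w) t = w t ^ 3 - lam * w t + cos t)
    (hw0 : -b ≤ w 0) (hw0' : deriv w 0 = 0)
    (hwmono : ∀ t ∈ Ioc (0 : ℝ) T, 0 < deriv w t) (hwT : w T = b) :
    IsSpike ε lam b T w (deriv w) := by
  have hw1 : ContDiff ℝ 1 (deriv w) := (contDiff_succ_iff_deriv (n := 1).1 hw).2.2
  have hmono : MonotoneOn w (Icc 0 T) := by
    refine monotoneOn_of_deriv_nonneg (convex_Icc _ _) hw.continuous.continuousOn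
      (hw.differentiable (by norm_num)).differentiableOn fun t ht => ?_
    rw [interior_Icc] at ht
    exact (hwmono t ⟨ht.1, ht.2.le⟩).le
  refine ⟨hT1, hT2, fun t => (hw.differentiable (by norm_num) t).hasDerivAt, hw1.continuous,
    fun t ht => ?_, hw0', hwmono, hwT⟩
  have hd := (hw1.differentiable (by norm_num) t).hasDerivAt
  rw [clippedField_of_mem ⟨hw0.trans (hmono ⟨le_rfl, hT1.le⟩ ht ht.1),
    hwT ▸ hmono ht ⟨hT1.le, le_rfl⟩ ht.2⟩, ← hweq t ht, mul_div_cancel_left₀ _ (by positivity)]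
  exact hd

lemma IsSecondOrderSol.contDiff {F : ℝ → ℝ → ℝ} {u v : ℝ → ℝ} (h : IsSecondOrderSol F u v)
    (hF : Continuous fun t => F t (u t)) : ContDiff ℝ 2 u := by
  have hu : deriv u = v := funext fun t => (h t).1.deriv
  have hv : deriv v = fun t => F t (u t) := funext fun t => (h t).2.deriv
  refine contDiff_succ_iff_deriv (n := 1).2 ⟨fun t => (h t).1.differentiableAt, by simp, ?_⟩
  rw [hu]
  exact contDiff_one_iff_deriv.2 ⟨fun t => (h t).2.differentiableAt, by rwa [hv]⟩

lemma IsShooting.even {ε lam b : ℝ} {U V : ℝ → ℝ → ℝ} (h : IsShooting ε lam b U V) (hb : 0 < b)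
    (α t : ℝ) : U α (-t) = U α t := by
  obtain ⟨K, hK⟩ := exists_lipschitzWith_clippedField ε lam hb
  exact congrFun ((h.sol α).reflect.unique hK (h.sol α) (t₀ := 0) (by simp)
    (by simp [h.rest])).1 t

/-- Chaos theorem: under Condition A (spike solution `w` on `[0,T]` with
`w(0) = ᾱ ∈ (α₀, −√(λ/3))`, `w'(0) = 0`, `w' > 0` on `(0,T]`, `w(T) = b`) and
`λ > λ₀ = 3/2^(2/3)`, for every set `S` of positive integers containing no two
consecutive integers there is `α ∈ (α₀, ᾱ)` such that the solution `u_α` exists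
on all of `ℝ` and intersects the spike `ŵ_j(t) = (−1)^j·w(|t − jπ|)` exactly for
those positive integers `j` lying in `S`. -/
theorem stmt_8 (ε lam b α₀ abar T : ℝ) (w : ℝ → ℝ) (S : Set ℕ)
    (hε : 0 < ε) (hlam : (3 : ℝ) / (2 : ℝ) ^ ((2 : ℝ) / 3) < lam)
    (hb : 0 < b) (hb3 : 1 < b ^ 3 - lam * b)
    (hα₀root : α₀ ^ 3 - lam * α₀ + 1 = 0)
    (hα₀least : ∀ y : ℝ, y ^ 3 - lam * y + 1 = 0 → α₀ ≤ y)
    (habar1 : α₀ < abar) (habar2 : abar < -Real.sqrt (lam / 3))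
    (hT1 : 0 < T) (hT2 : T < π / 2)
    (hw : ContDiff ℝ 2 w)
    (hweq : ∀ t ∈ Icc (0 : ℝ) T,
      ε ^ 2 * deriv (deriv w) t = w t ^ 3 - lam * w t + Real.cos t)
    (hw0 : w 0 = abar) (hw0' : deriv w 0 = 0)
    (hwmono : ∀ t ∈ Ioc (0 : ℝ) T, 0 < deriv w t) (hwT : w T = b)
    (hSpos : ∀ j ∈ S, 0 < j)
    (hSgap : ∀ j : ℕ, ¬(j ∈ S ∧ j + 1 ∈ S)) :
    ∃ α ∈ Ioo α₀ abar, ∃ u : ℝ → ℝ, ContDiff ℝ 2 u ∧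
      (∀ t : ℝ, ε ^ 2 * deriv (deriv u) t = u t ^ 3 - lam * u t + Real.cos t) ∧
      u 0 = α ∧ deriv u 0 = 0 ∧
      ∀ j : ℕ, 0 < j →
        ((∃ t : ℝ, |t - (j : ℝ) * π| ≤ T ∧
          u t = (-1 : ℝ) ^ j * w (|t - (j : ℝ) * π|)) ↔ j ∈ S) := by
  have hd := isDuffing_sqrt hε hlam hb hb3 hα₀root (habar1.trans habar2)
  have hk := hd.k_pos
  have hkb := hd.k_lt
  have hnb := hd.neg_lt_root
  have hspike := isSpike_of_contDiff hε hT1 hT2 hw hweq (by rw [hw0]; linarith) hw0' hwmono hwT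
  obtain ⟨U, V, hU⟩ := exists_isShooting ε lam hb
  obtain ⟨α, hα, hF⟩ := hU.exists_follows hd hspike hw0 habar1 habar2
    (fun h => (hSpos 0 h).false) hSgap
  have hαb : α ∈ Ioo (-b) b := ⟨hnb.trans_le hα.1, hα.2.trans_lt (by linarith)⟩
  have hlt := fun n t => hU.abs_lt_of_follows hd habar2 hSgap hαb hF n (t := t)
  have hmem : ∀ t, U α t ∈ Icc (-b) b := by
    intro t
    have h0 := hlt 0 |t| (abs_nonneg t)
    have h1 := hlt 1 |t| (abs_nonneg t)
    have hev : U α |t| = U α t := by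
      rcases abs_choice t with h | h <;> rw [h]
      exact hU.even hb α t
    rw [hev] at h0 h1
    exact ⟨by linarith, by linarith⟩
  have hu : deriv (U α) = V α := funext fun t => (hU.sol α t).1.deriv
  refine ⟨α, ⟨lt_of_le_of_ne hα.1 ?_, lt_of_le_of_ne hα.2 ?_⟩, U α, ?_, fun t => ?_, hU.start α, ?_,
    fun j hj => hU.meets_iff_of_follows hd hspike hw0 habar2 hSgap hαb hF hj⟩
  · rintro rfl
    obtain ⟨t, ht, hUt⟩ := hU.root_exits hd
    linarith [hlt 1 t ht]
  · rintro rfl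
    have := hU.le_of_gate hd hspike hαb 0 (by simp [hU.start, hw0]) le_rfl
    exact absurd this (not_le.2 (hlt 0 _ (by simpa using hT1.le)))
  · refine (hU.sol α).contDiff ?_
    have := (hU.sol α).continuous
    unfold clippedField
    fun_prop
  · rw [hu, (hU.sol α t).2.deriv, clippedField_of_mem (hmem t),
      mul_div_cancel₀ _ (by positivity)]
  · rw [hu, hU.rest α]
end

section
/- Let λ ≥ λ₀ = 3/2^(2/3), let b = √(λ + 1/(2λ)), and define T_λ := 2·√(b + √λ) if λ₀ ≤ λ < 4, and T_λ := 2√2 + (√2·ln(√λ − 1))/√λ + 2·(√(b + √λ) − √(2√λ − 2)) if λ ≥ 4; set ε_λ := π/(3·T_λ). Let 0 < ε ≤ ε_λ, and let v be the solution of v''(τ) = v(τ)³ − λ·v(τ) + cos(ε·τ) with v(0) = −√λ and v'(0) = 0. Then there exists T with 0 < T < T_λ and T ≤ π/(3ε) such that v is defined on [0, T], v'(τ) > 0 for all τ ∈ (0, T], and v(T) = b. -/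
open Real Set

/-- Global solvability on `[0, T]` of `v'' = g(v) + p(τ)` for a Lipschitz `g` and a bounded
right-hand side, by a solution that is `C²` on the whole line. -/
theorem exists_contDiff_two_solution {g p : ℝ → ℝ} {K : NNReal} {G T : ℝ}
    (hg : LipschitzWith K g) (hp : Continuous p) (hG : ∀ x t, |g x + p t| ≤ G)
    (hT : 0 ≤ T) (x₀ : ℝ) :
    ∃ v : ℝ → ℝ, ContDiff ℝ 2 v ∧
      (∀ τ ∈ Icc 0 T, deriv (deriv v) τ = g (v τ) + p τ) ∧ v 0 = x₀ ∧ deriv v 0 = 0 := by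
  have hG0 : 0 ≤ G := (abs_nonneg _).trans (hG 0 0)
  have hW : -(G * T) ≤ G * T := by nlinarith [mul_nonneg hG0 hT]
  -- The velocity is truncated to `[-GT, GT]`, which makes the vector field bounded.
  set c : ℝ → ℝ := fun y ↦ (projIcc (-(G * T)) (G * T) hW y : ℝ) with hc
  have hclip : LipschitzWith 1 c := by
    rw [← one_mul (1 : NNReal)]
    exact (LipschitzWith.subtype_val _).comp (LipschitzWith.projIcc hW)
  have hcb : ∀ y, |c y| ≤ G * T := fun y ↦ abs_le.2 (projIcc _ _ hW y).2
  set f : ℝ → ℝ × ℝ → ℝ × ℝ := fun t z ↦ (c z.2, g z.1 + p t) with hf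
  have hlip : ∀ t, LipschitzWith (max 1 K) (f t) := by
    intro t
    have h1 : LipschitzWith 1 fun z : ℝ × ℝ ↦ c z.2 := by
      rw [← one_mul (1 : NNReal)]
      exact hclip.comp LipschitzWith.prod_snd
    have h2 : LipschitzWith K fun z : ℝ × ℝ ↦ g z.1 + p t := by
      simpa using (hg.comp LipschitzWith.prod_fst).add (LipschitzWith.const (p t))
    exact h1.prodMk h2
  set L : NNReal := ⟨max (G * T) G, le_max_of_le_right hG0⟩
  have hpl : IsPicardLindelof f (⟨0, left_mem_Icc.2 hT⟩ : Icc 0 T) (x₀, (0 : ℝ))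
      (L * T.toNNReal) 0 L (max 1 K) :=
    { lipschitzOnWith := fun t _ ↦ (hlip t).lipschitzOnWith
      continuousOn := fun x _ ↦ by
        simp only [hf]
        fun_prop
      norm_le := fun t _ x _ ↦ by
        rw [Prod.norm_def]
        exact max_le_max (hcb _) (hG _ _)
      mul_max_le := by simp [hT] }
  obtain ⟨α, hα0, hα⟩ := hpl.exists_eq_forall_mem_Icc_hasDerivWithinAt₀
  simp only at hα0
  have hαc : ContinuousOn α (Icc 0 T) := fun t ht ↦ (hα t ht).continuousWithinAt
  have hx : ∀ t ∈ Icc 0 T, HasDerivWithinAt (fun t ↦ (α t).1) (c (α t).2) (Icc 0 T) t :=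
    fun t ht ↦ ((ContinuousLinearMap.fst ℝ ℝ ℝ).hasFDerivAt.comp_hasDerivWithinAt t (hα t ht))
  have hy : ∀ t ∈ Icc 0 T, HasDerivWithinAt (fun t ↦ (α t).2) (g (α t).1 + p t) (Icc 0 T) t :=
    fun t ht ↦ ((ContinuousLinearMap.snd ℝ ℝ ℝ).hasFDerivAt.comp_hasDerivWithinAt t (hα t ht))
  have hIci : ∀ {u : ℝ → ℝ} {u' t : ℝ}, t ∈ Ico 0 T → HasDerivWithinAt u u' (Icc 0 T) t →
      HasDerivWithinAt u u' (Ici t) t := fun ht h ↦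
    (h.mono (Icc_subset_Icc_left ht.1)).mono_of_mem_nhdsWithin (Icc_mem_nhdsGE ht.2)
  have hyb : ∀ t ∈ Icc 0 T, c (α t).2 = (α t).2 := by
    intro t ht
    have h := norm_image_sub_le_of_norm_deriv_le_segment' hy (fun x _ ↦ hG _ _) t ht
    have hb : |(α t).2| ≤ G * T := by
      have h0 : (α 0).2 = 0 := by rw [hα0]
      rw [h0, sub_zero, sub_zero, Real.norm_eq_abs] at h
      exact h.trans (mul_le_mul_of_nonneg_left ht.2 hG0)
    simp only [hc, projIcc_of_mem hW (abs_le.1 hb)]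
  set h : ℝ → ℝ := fun t ↦ g (α (projIcc 0 T hT t)).1 + p t with hh
  have hhc : Continuous h := by
    have : Continuous fun t ↦ α (projIcc 0 T hT t) :=
      hαc.comp_continuous (continuous_subtype_val.comp continuous_projIcc) fun t ↦ Subtype.prop _
    exact (hg.continuous.comp this.fst).add hp
  set w : ℝ → ℝ := fun t ↦ ∫ τ in (0 : ℝ)..t, h τ with hw
  have hwd : ∀ t, HasDerivAt w (h t) t := fun t ↦ hhc.integral_hasStrictDerivAt 0 t |>.hasDerivAt
  have hwc : Continuous w := continuous_iff_continuousAt.2 fun t ↦ (hwd t).continuousAt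
  set v : ℝ → ℝ := fun t ↦ x₀ + ∫ τ in (0 : ℝ)..t, w τ with hv
  have hvd : ∀ t, HasDerivAt v (w t) t := fun t ↦
    (hwc.integral_hasStrictDerivAt 0 t |>.hasDerivAt).const_add x₀
  have hvc : Continuous v := continuous_iff_continuousAt.2 fun t ↦ (hvd t).continuousAt
  have hdv : deriv v = w := funext fun t ↦ (hvd t).deriv
  have hdw : deriv w = h := funext fun t ↦ (hwd t).deriv
  have hhα : ∀ t ∈ Icc 0 T, h t = g (α t).1 + p t := fun t ht ↦ by
    simp only [hh, projIcc_of_mem hT ht]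
  have hwα : ∀ t ∈ Icc 0 T, w t = (α t).2 := by
    refine eq_of_has_deriv_right_eq (f' := h) (fun t _ ↦ (hwd t).hasDerivWithinAt) ?_
      hwc.continuousOn hαc.snd ?_
    · intro t ht
      rw [hhα t (Ico_subset_Icc_self ht)]
      exact hIci ht (hy t (Ico_subset_Icc_self ht))
    · simp [hw, hα0]
  have hvα : ∀ t ∈ Icc 0 T, v t = (α t).1 := by
    refine eq_of_has_deriv_right_eq (f' := w) (fun t _ ↦ (hvd t).hasDerivWithinAt) ?_
      hvc.continuousOn hαc.fst ?_
    · intro t ht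
      have ht' := Ico_subset_Icc_self ht
      rw [hwα t ht', ← hyb t ht']
      exact hIci ht (hx t ht')
    · simp [hv, hα0]
  refine ⟨v, ?_, ?_, by simp [hv], by simp [hdv, hw]⟩
  · have hw1 : ContDiff ℝ 1 w :=
      contDiff_one_iff_deriv.2 ⟨fun t ↦ (hwd t).differentiableAt, by rwa [hdw]⟩
    rw [show (2 : WithTop ℕ∞) = 1 + 1 by norm_num, contDiff_succ_iff_deriv]
    exact ⟨fun t ↦ (hvd t).differentiableAt, by simp, by rwa [hdv]⟩
  · intro τ hτ
    rw [hdv, hdw, hhα τ hτ, hvα τ hτ]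

/-- The first two derivatives of a `C²` function on the line. -/
theorem ContDiff.hasDerivAt_deriv_of_two {v : ℝ → ℝ} (hv : ContDiff ℝ 2 v) :
    (∀ t, HasDerivAt v (deriv v t) t) ∧ ∀ t, HasDerivAt (deriv v) (deriv (deriv v) t) t := by
  rw [show (2 : WithTop ℕ∞) = 1 + 1 by norm_num, contDiff_succ_iff_deriv] at hv
  exact ⟨fun t ↦ (hv.1 t).hasDerivAt,
    fun t ↦ ((hv.2.2.differentiable one_ne_zero) t).hasDerivAt⟩

/-- Uniqueness for `v'' = g(v) + p(τ)` on `[0, T]` with `g` of class `C¹`. -/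
theorem eqOn_of_second_order_ode {g p v w : ℝ → ℝ} {T : ℝ} (hg : ContDiff ℝ 1 g)
    (hv : ContDiff ℝ 2 v) (hw : ContDiff ℝ 2 w)
    (hv' : ∀ τ ∈ Icc 0 T, deriv (deriv v) τ = g (v τ) + p τ)
    (hw' : ∀ τ ∈ Icc 0 T, deriv (deriv w) τ = g (w τ) + p τ)
    (h0 : v 0 = w 0) (h0' : deriv v 0 = deriv w 0) :
    EqOn v w (Icc 0 T) ∧ EqOn (deriv v) (deriv w) (Icc 0 T) := by
  obtain ⟨hv1, hv2⟩ := hv.hasDerivAt_deriv_of_two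
  obtain ⟨hw1, hw2⟩ := hw.hasDerivAt_deriv_of_two
  have hvz : ∀ t, HasDerivAt (fun t ↦ (v t, deriv v t)) (deriv v t, deriv (deriv v) t) t :=
    fun t ↦ (hv1 t).prodMk (hv2 t)
  have hwz : ∀ t, HasDerivAt (fun t ↦ (w t, deriv w t)) (deriv w t, deriv (deriv w) t) t :=
    fun t ↦ (hw1 t).prodMk (hw2 t)
  have hcv : Continuous fun t ↦ (v t, deriv v t) :=
    continuous_iff_continuousAt.2 fun t ↦ (hvz t).continuousAt
  have hcw : Continuous fun t ↦ (w t, deriv w t) :=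
    continuous_iff_continuousAt.2 fun t ↦ (hwz t).continuousAt
  set s := (fun t ↦ (v t, deriv v t)) '' Icc 0 T ∪ (fun t ↦ (w t, deriv w t)) '' Icc 0 T with hs
  have hcomp : IsCompact s := (isCompact_Icc.image hcv).union (isCompact_Icc.image hcw)
  have hloc : LocallyLipschitz fun z : ℝ × ℝ ↦ (z.2, g z.1) :=
    ContDiff.locallyLipschitz (𝕂 := ℝ) (contDiff_snd.prodMk (hg.comp contDiff_fst))
  obtain ⟨K, hK⟩ :=
    LocallyLipschitzOn.exists_lipschitzOnWith_of_compact hcomp (hloc.locallyLipschitzOn)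
  have key := ODE_solution_unique_of_mem_Icc_right (v := fun t z ↦ (z.2, g z.1) + (0, p t))
    (s := fun _ ↦ s) (K := K) (a := 0) (b := T) (f := fun t ↦ (v t, deriv v t))
    (g := fun t ↦ (w t, deriv w t))
    (fun t _ ↦ by simpa using hK.add (LipschitzWith.const ((0 : ℝ), p t)).lipschitzOnWith) hcv.continuousOn
    (fun t ht ↦ by
      have := (hvz t).hasDerivWithinAt (s := Ici t)
      rw [hv' t (Ico_subset_Icc_self ht)] at this
      simpa using this)
    (fun t ht ↦ Or.inl (mem_image_of_mem _ (Ico_subset_Icc_self ht))) hcw.continuousOn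
    (fun t ht ↦ by
      have := (hwz t).hasDerivWithinAt (s := Ici t)
      rw [hw' t (Ico_subset_Icc_self ht)] at this
      simpa using this)
    (fun t ht ↦ Or.inr (mem_image_of_mem _ (Ico_subset_Icc_self ht))) (by simp [h0, h0'])
  exact ⟨fun t ht ↦ congrArg Prod.fst (key ht), fun t ht ↦ congrArg Prod.snd (key ht)⟩

/-- A strict energy inequality for increasing solutions of the forced Duffing equation as long as
`cos (ε τ) ≥ 1 / 2`. -/
theorem duffing_energy_lt {v : ℝ → ℝ} {s ε S : ℝ} (hv : ContDiff ℝ 2 v) (hε : 0 < ε) (hS : 0 < S)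
    (hεS : ε * S ≤ π / 3)
    (hode : ∀ τ ∈ Icc 0 S, deriv (deriv v) τ = v τ ^ 3 - s ^ 2 * v τ + cos (ε * τ))
    (h0 : v 0 = -s) (h0' : deriv v 0 = 0) (hpos : ∀ τ ∈ Ioo 0 S, 0 < deriv v τ) :
    (s ^ 2 - v S ^ 2) ^ 2 / 2 + (v S + s) < deriv v S ^ 2 := by
  obtain ⟨hv1, hv2⟩ := hv.hasDerivAt_deriv_of_two
  set E : ℝ → ℝ := fun τ ↦ deriv v τ ^ 2 - (s ^ 2 - v τ ^ 2) ^ 2 / 2 - (v τ + s) with hE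
  have hEd : ∀ τ, HasDerivAt E (2 * deriv v τ * deriv (deriv v) τ
      - 2 * (s ^ 2 - v τ ^ 2) * (-(2 * v τ * deriv v τ)) / 2 - deriv v τ) τ := by
    intro τ
    convert! (((hv2 τ).pow 2).sub (((((hv1 τ).pow 2).const_sub (s ^ 2)).pow 2).div_const 2)).sub
      ((hv1 τ).add_const s) using 1
    simp
  have hmono : StrictMonoOn E (Icc 0 S) := by
    refine strictMonoOn_of_deriv_pos (convex_Icc 0 S)
      (fun τ _ ↦ (hEd τ).continuousAt.continuousWithinAt) fun τ hτ ↦ ?_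
    rw [interior_Icc] at hτ
    rw [(hEd τ).deriv, hode τ (Ioo_subset_Icc_self hτ)]
    have hcos : 1 / 2 < cos (ε * τ) := by
      rw [← cos_pi_div_three]
      refine cos_lt_cos_of_nonneg_of_le_pi (mul_pos hε hτ.1).le (by linarith [pi_pos]) ?_
      exact (mul_lt_mul_of_pos_left hτ.2 hε).trans_le hεS
    nlinarith [mul_pos (hpos τ hτ) (sub_pos.2 hcos)]
  have := hmono (left_mem_Icc.2 hS.le) (right_mem_Icc.2 hS.le) hS
  simp only [hE, h0, h0'] at this
  nlinarith

/-- As long as the solution stays below `b`, it is strictly increasing. -/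
theorem duffing_deriv_pos {v : ℝ → ℝ} {s b ε T : ℝ} (hv : ContDiff ℝ 2 v) (hε : 0 < ε)
    (hT : 0 < T) (hεT : ε * T ≤ π / 3)
    (hode : ∀ τ ∈ Icc 0 T, v τ ∈ Icc (-s) b →
      deriv (deriv v) τ = v τ ^ 3 - s ^ 2 * v τ + cos (ε * τ))
    (h0 : v 0 = -s) (h0' : deriv v 0 = 0) (hle : ∀ τ ∈ Icc 0 T, v τ ≤ b) :
    ∀ τ ∈ Ioc 0 T, 0 < deriv v τ := by
  obtain ⟨hv1, hv2⟩ := hv.hasDerivAt_deriv_of_two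
  have hvc : Continuous v := hv.continuous
  have hdc : Continuous (deriv v) := continuous_iff_continuousAt.2 fun t ↦ (hv2 t).continuousAt
  have h0mem : (0 : ℝ) ∈ Icc 0 T := left_mem_Icc.2 hT.le
  have h00 : deriv (deriv v) 0 = 1 := by
    rw [hode 0 h0mem ⟨h0.ge, hle 0 h0mem⟩, h0]
    simp
    ring
  obtain ⟨δ, hδ, hδpos⟩ : ∃ δ > 0, ∀ τ ∈ Ioo 0 δ, 0 < deriv v τ := by
    have hev := eventually_nhdsWithin_sign_eq_of_deriv_pos (h00 ▸ one_pos) h0'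
    obtain ⟨δ, hδ, h⟩ := Metric.eventually_nhds_iff.1 hev
    refine ⟨δ, hδ, fun τ hτ ↦ ?_⟩
    have := h (y := τ) (by rw [Real.dist_eq, sub_zero, abs_of_pos hτ.1]; exact hτ.2)
    rwa [sub_zero, sign_pos hτ.1, sign_eq_one_iff] at this
  intro τ hτ
  by_contra! hneg
  have hδτ : δ ≤ τ := by
    by_contra! h
    exact hneg.not_gt (hδpos τ ⟨hτ.1, h⟩)
  obtain ⟨S, ⟨⟨hS1, hSτ⟩, hS2⟩, hSmin⟩ :=
    (isCompact_Icc.inter_right (isClosed_le hdc continuous_const) :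
      IsCompact (Icc (δ / 2) τ ∩ {t | deriv v t ≤ 0})).exists_isLeast
      ⟨τ, ⟨by linarith, le_rfl⟩, hneg⟩
  have hS0 : 0 < S := by linarith
  have hST : S ≤ T := hSτ.trans hτ.2
  have hpos : ∀ t ∈ Ioo 0 S, 0 < deriv v t := by
    intro t ht
    by_contra! h
    rcases lt_or_ge t δ with htδ | htδ
    · exact h.not_gt (hδpos t ⟨ht.1, htδ⟩)
    · exact ht.2.not_ge (hSmin ⟨⟨by linarith, by linarith [ht.2]⟩, h⟩)
  have hmono : StrictMonoOn v (Icc 0 S) := by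
    refine strictMonoOn_of_deriv_pos (convex_Icc 0 S) hvc.continuousOn fun t ht ↦ ?_
    rw [interior_Icc] at ht
    exact hpos t ht
  have hS00 : (0 : ℝ) ∈ Icc 0 S := left_mem_Icc.2 hS0.le
  have hSS : S ∈ Icc 0 S := right_mem_Icc.2 hS0.le
  have hen := duffing_energy_lt hv hε hS0
    ((mul_le_mul_of_nonneg_left hST hε.le).trans hεT) (fun t ht ↦ by
      have ht' : t ∈ Icc 0 T := ⟨ht.1, ht.2.trans hST⟩
      exact hode t ht' ⟨h0 ▸ hmono.monotoneOn hS00 ht ht.1, hle t ht'⟩) h0 h0' hpos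
  have hvS := hmono hS00 hSS hS0
  have hd0 : 0 ≤ deriv v S := by
    have hcl : closure (Ioo 0 S) ⊆ {t | 0 ≤ deriv v t} :=
      closure_minimal (fun t ht ↦ (hpos t ht).le) (isClosed_le continuous_const hdc)
    rw [closure_Ioo hS0.ne] at hcl
    exact hcl hSS
  have hd : deriv v S = 0 := le_antisymm hS2 hd0
  rw [hd] at hen
  nlinarith [sq_nonneg (s ^ 2 - v S ^ 2)]

/-- A function with derivative larger than `1` grows by more than the elapsed time. -/
theorem sub_lt_sub_of_one_lt_deriv {F F' : ℝ → ℝ} {a c : ℝ} (hac : a < c)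
    (hc : ContinuousOn F (Icc a c)) (hd : ∀ t ∈ Ioo a c, HasDerivAt F (F' t) t)
    (h1 : ∀ t ∈ Ioo a c, 1 < F' t) : c - a < F c - F a := by
  obtain ⟨t, ht, h⟩ := exists_hasDerivAt_eq_slope F F' hac hc hd
  have := h1 t ht
  rwa [h, one_lt_div (sub_pos.2 hac)] at this

/-- Travel-time estimate from `v' > √(v + s)`. -/
theorem travel_time_sqrt {v : ℝ → ℝ} {s a c : ℝ} (hac : a < c) (hv : Differentiable ℝ v)
    (hs : ∀ t ∈ Ioo a c, 0 < v t + s) (hd : ∀ t ∈ Ioo a c, v t + s < deriv v t ^ 2)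
    (hpos : ∀ t ∈ Ioo a c, 0 < deriv v t) :
    c - a < 2 * √(v c + s) - 2 * √(v a + s) := by
  refine sub_lt_sub_of_one_lt_deriv (F := fun t ↦ 2 * √(v t + s))
    (F' := fun t ↦ 2 * (deriv v t / (2 * √(v t + s)))) hac
    (by have := hv.continuous; fun_prop) (fun t ht ↦ ?_) fun t ht ↦ ?_
  · exact (((hv t).hasDerivAt.add_const s).sqrt (hs t ht).ne').const_mul 2
  · have h : 0 < √(v t + s) := sqrt_pos.2 (hs t ht)
    have h2 : √(v t + s) < deriv v t := (sqrt_lt' (hpos t ht)).2 (hd t ht)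
    rw [← mul_div_assoc, mul_div_mul_left _ _ (two_ne_zero' ℝ)]
    exact (one_lt_div h).2 h2

/-- Travel-time estimate from `v' > (s² - v²) / √2`. -/
theorem travel_time_log {v : ℝ → ℝ} {s a c : ℝ} (hac : a < c) (hv : Differentiable ℝ v)
    (hs : ∀ t ∈ Icc a c, v t ∈ Ioo (-s) s)
    (hd : ∀ t ∈ Ioo a c, (s ^ 2 - v t ^ 2) ^ 2 / 2 < deriv v t ^ 2)
    (hpos : ∀ t ∈ Ioo a c, 0 < deriv v t) :
    c - a < √2 / (2 * s) * (log (s + v c) - log (s - v c)) -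
      √2 / (2 * s) * (log (s + v a) - log (s - v a)) := by
  have hd1 : ∀ t ∈ Icc a c, HasDerivAt (fun t ↦ √2 / (2 * s) * (log (s + v t) - log (s - v t)))
      (√2 / (2 * s) * (deriv v t / (s + v t) - -deriv v t / (s - v t))) t := by
    intro t ht
    have h1 := ((hv t).hasDerivAt.const_add s).log (by linarith [(hs t ht).1])
    have h2 := ((hv t).hasDerivAt.const_sub s).log (by linarith [(hs t ht).2])
    exact (h1.sub h2).const_mul _
  refine sub_lt_sub_of_one_lt_deriv hac
    (fun t ht ↦ (hd1 t ht).continuousAt.continuousWithinAt)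
    (fun t ht ↦ hd1 t (Ioo_subset_Icc_self ht)) fun t ht ↦ ?_
  obtain ⟨h1, h2⟩ := hs t (Ioo_subset_Icc_self ht)
  have hp1 : 0 < s + v t := by linarith
  have hp2 : 0 < s - v t := by linarith
  have hs0 : 0 < s := by linarith
  have hq : √2 ^ 2 = 2 := sq_sqrt zero_le_two
  have heq : √2 / (2 * s) * (deriv v t / (s + v t) - -deriv v t / (s - v t)) =
      √2 * deriv v t / ((s + v t) * (s - v t)) := by
    field_simp
    ring
  rw [heq, one_lt_div (mul_pos hp1 hp2)]
  refine lt_of_pow_lt_pow_left₀ 2 (by have := hpos t ht; positivity) ?_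
  rw [mul_pow √2, hq]
  linear_combination 2 * hd t ht

/-- The travel time bound `T_λ` written in terms of `s = √λ`. -/
noncomputable def duffingTime (s b : ℝ) : ℝ :=
  if s < 2 then 2 * √(b + s)
  else 2 * √2 + √2 * log (s - 1) / s + 2 * (√(b + s) - √(2 * s - 2))

theorem duffingTime_pos {s b : ℝ} (hs : 0 < s) (hb : s ≤ b) : 0 < duffingTime s b := by
  unfold duffingTime
  split_ifs with h
  · have : 0 < √(b + s) := sqrt_pos.2 (by linarith)
    positivity
  · have h1 : 0 ≤ log (s - 1) := log_nonneg (by linarith)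
    have h2 : √(2 * s - 2) ≤ √(b + s) := sqrt_le_sqrt (by linarith)
    have h3 : 0 ≤ √2 * log (s - 1) / s := by positivity
    have h4 : 0 < √2 := by positivity
    linarith

/-- A solution that is increasing, below `b`, and satisfies the energy inequality on `[0, T]`
cannot survive up to time `duffingTime s b`. -/
theorem lt_duffingTime {v : ℝ → ℝ} {s b T : ℝ} (hs : 0 < s) (hb : s ≤ b) (hT : 0 < T)
    (hv : Differentiable ℝ v) (h0 : v 0 = -s) (hle : v T ≤ b)
    (hpos : ∀ t ∈ Ioc 0 T, 0 < deriv v t)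
    (hen : ∀ t ∈ Ioc 0 T, (s ^ 2 - v t ^ 2) ^ 2 / 2 + (v t + s) < deriv v t ^ 2) :
    T < duffingTime s b := by
  have hmono : StrictMonoOn v (Icc 0 T) := by
    refine strictMonoOn_of_deriv_pos (convex_Icc 0 T) hv.continuous.continuousOn fun t ht ↦ ?_
    rw [interior_Icc] at ht
    exact hpos t (Ioo_subset_Ioc_self ht)
  have h0T : (0 : ℝ) ∈ Icc 0 T := left_mem_Icc.2 hT.le
  have hTT : T ∈ Icc 0 T := right_mem_Icc.2 hT.le
  have hvpos : ∀ t ∈ Ioc 0 T, 0 < v t + s := fun t ht ↦ by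
    linarith [hmono h0T (Ioc_subset_Icc_self ht) ht.1]
  have hsub : ∀ {a c t : ℝ}, 0 ≤ a → c ≤ T → t ∈ Ioo a c → t ∈ Ioc 0 T := fun ha hc ht ↦
    ⟨ha.trans_lt ht.1, ht.2.le.trans hc⟩
  have hA : ∀ a c, 0 ≤ a → a < c → c ≤ T → c - a < 2 * √(v c + s) - 2 * √(v a + s) :=
    fun a c ha hac hc ↦ travel_time_sqrt hac hv (fun t ht ↦ hvpos t (hsub ha hc ht))
      (fun t ht ↦ by nlinarith [hen t (hsub ha hc ht), sq_nonneg (s ^ 2 - v t ^ 2)])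
      (fun t ht ↦ hpos t (hsub ha hc ht))
  have hA0 : ∀ c, 0 < c → c ≤ T → c < 2 * √(v c + s) := fun c h1 h2 ↦ by
    simpa [h0] using hA 0 c le_rfl h1 h2
  have hB : ∀ a c, 0 < a → a < c → c ≤ T → v c < s →
      c - a < √2 / (2 * s) * (log (s + v c) - log (s - v c)) -
        √2 / (2 * s) * (log (s + v a) - log (s - v a)) := by
    intro a c ha hac hc hvc
    refine travel_time_log hac hv (fun t ht ↦ ?_)
      (fun t ht ↦ by linarith [hen t (hsub ha.le hc ht), hvpos t (hsub ha.le hc ht)])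
      (fun t ht ↦ hpos t (hsub ha.le hc ht))
    have ht' : t ∈ Ioc 0 T := ⟨ha.trans_le ht.1, ht.2.trans hc⟩
    refine ⟨by linarith [hvpos t ht'], ?_⟩
    exact (hmono.monotoneOn (Ioc_subset_Icc_self ht') ⟨(ha.trans hac).le, hc⟩ ht.2).trans_lt hvc
  have hbT : √(v T + s) ≤ √(b + s) := sqrt_le_sqrt (by linarith)
  unfold duffingTime
  split_ifs with h
  · linarith [hA0 T hT le_rfl]
  · have hs2 : 2 ≤ s := not_lt.1 h
    have hlog : 0 ≤ √2 * log (s - 1) / s := by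
      have : 0 ≤ log (s - 1) := log_nonneg (by linarith)
      positivity
    have hC : √(2 * s - 2) ≤ √(b + s) := sqrt_le_sqrt (by linarith)
    have hivt : ∀ x, -s < x → x < v T → ∃ t ∈ Ioo 0 T, v t = x := fun x h1 h2 ↦
      intermediate_value_Ioo hT.le hv.continuous.continuousOn ⟨h0 ▸ h1, h2⟩
    rcases le_or_gt (v T) (2 - s) with h1 | h1
    · have : √(v T + s) ≤ √2 := sqrt_le_sqrt (by linarith)
      linarith [hA0 T hT le_rfl]
    obtain ⟨t₁, ht₁, hvt₁⟩ := hivt (2 - s) (by linarith) h1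
    have hT₁ : t₁ < 2 * √2 := by simpa [hvt₁] using hA0 t₁ ht₁.1 ht₁.2.le
    -- the middle passage, up to any level `x ≤ s - 2`
    have hmid : ∀ c, t₁ < c → c ≤ T → v c ≤ s - 2 → c - t₁ < √2 * log (s - 1) / s := by
      intro c h1c hcT hvc
      have hvc' : 2 - s < v c := hvt₁ ▸ hmono (Ioo_subset_Icc_self ht₁)
        ⟨(ht₁.1.trans h1c).le, hcT⟩ h1c
      refine (hB t₁ c ht₁.1 h1c hcT (by linarith)).trans_le ?_
      have e1 : log (s + v c) ≤ log (2 * (s - 1)) := log_le_log (by linarith) (by linarith)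
      have e2 : log 2 ≤ log (s - v c) := log_le_log (by norm_num) (by linarith)
      have e3 : log (2 * (s - 1)) = log 2 + log (s - 1) :=
        log_mul two_ne_zero (by linarith)
      have hk : 0 ≤ √2 / (2 * s) := by positivity
      rw [hvt₁, show s + (2 - s) = 2 by ring, show s - (2 - s) = 2 * (s - 1) by ring,
        ← mul_sub, show √2 * log (s - 1) / s = √2 / (2 * s) * (2 * log (s - 1)) by field_simp]
      exact mul_le_mul_of_nonneg_left (by linarith) hk
    rcases le_or_gt (v T) (s - 2) with h2 | h2
    · linarith [hmid T ht₁.2 le_rfl h2]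
    obtain ⟨t₂, ht₂, hvt₂⟩ := hivt (s - 2) (by linarith) h2
    have hT₂ : T - t₂ < 2 * √(v T + s) - 2 * √(2 * s - 2) := by
      have := hA t₂ T ht₂.1.le ht₂.2 le_rfl
      rwa [hvt₂, show s - 2 + s = 2 * s - 2 by ring] at this
    rcases lt_or_ge t₁ t₂ with h12 | h12
    · linarith [hmid t₂ h12 ht₂.2.le hvt₂.le]
    · linarith

/-- The solution starting from rest at `-s`, where `s = √λ`, increases up to the level `b ≥ s`
before time `duffingTime s b`. -/
theorem duffing_reaches {s b ε : ℝ} (hs : 0 < s) (hb : s ≤ b) (hε : 0 < ε)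
    (hεT : ε * duffingTime s b ≤ π / 3) :
    ∃ T, 0 < T ∧ T < duffingTime s b ∧ ∃ v : ℝ → ℝ, ContDiff ℝ 2 v ∧
      (∀ τ ∈ Icc 0 T, deriv (deriv v) τ = v τ ^ 3 - s ^ 2 * v τ + cos (ε * τ)) ∧
      v 0 = -s ∧ deriv v 0 = 0 ∧ (∀ τ ∈ Ioc 0 T, 0 < deriv v τ) ∧ v T = b := by
  have hT₀ : 0 < duffingTime s b := duffingTime_pos hs hb
  set T₀ := duffingTime s b
  have hsb : -s ≤ b := by linarith
  set φ : ℝ → ℝ := fun x ↦ x ^ 3 - s ^ 2 * x with hφ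
  set g : ℝ → ℝ := fun x ↦ φ (projIcc (-s) b hsb x) with hg
  have hφd : ContDiff ℝ 1 φ := by
    simp only [hφ]
    fun_prop
  obtain ⟨K, hK⟩ := hφd.contDiffOn.exists_lipschitzOnWith one_ne_zero (convex_Icc (-s) b)
    isCompact_Icc
  have hgl : LipschitzWith (K * 1) g :=
    (lipschitzOnWith_iff_restrict.1 hK).comp (LipschitzWith.projIcc hsb)
  obtain ⟨C, hC⟩ := isCompact_Icc.exists_bound_of_continuousOn
    (hφd.continuous.continuousOn (s := Icc (-s) b))
  obtain ⟨v, hv, hvode, h0, h0'⟩ := exists_contDiff_two_solution (p := fun t ↦ cos (ε * t))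
    (G := C + 1) hgl (by fun_prop) (fun x t ↦ (abs_add_le _ _).trans
      (add_le_add (hC _ (Subtype.prop _)) (abs_cos_le_one _))) hT₀.le (-s)
  have hode : ∀ τ ∈ Icc 0 T₀, v τ ∈ Icc (-s) b →
      deriv (deriv v) τ = v τ ^ 3 - s ^ 2 * v τ + cos (ε * τ) := fun τ hτ hm ↦ by
    rw [hvode τ hτ]
    simp only [hg, hφ, projIcc_of_mem hsb hm]
  have hvdiff : Differentiable ℝ v := fun t ↦ (hv.hasDerivAt_deriv_of_two.1 t).differentiableAt
  have hvc : Continuous v := hv.continuous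
  have main : ∀ T, 0 < T → T ≤ T₀ → (∀ τ ∈ Icc 0 T, v τ ≤ b) →
      (∀ τ ∈ Ioc 0 T, 0 < deriv v τ) ∧
      (∀ τ ∈ Icc 0 T, deriv (deriv v) τ = v τ ^ 3 - s ^ 2 * v τ + cos (ε * τ)) ∧ T < T₀ := by
    intro T hT hTT hle
    have hεT' : ε * T ≤ π / 3 := (mul_le_mul_of_nonneg_left hTT hε.le).trans hεT
    have hpos := duffing_deriv_pos hv hε hT hεT'
      (fun τ hτ ↦ hode τ ⟨hτ.1, hτ.2.trans hTT⟩) h0 h0' hle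
    have hmono : StrictMonoOn v (Icc 0 T) := by
      refine strictMonoOn_of_deriv_pos (convex_Icc 0 T) hvc.continuousOn fun t ht ↦ ?_
      rw [interior_Icc] at ht
      exact hpos t (Ioo_subset_Ioc_self ht)
    have hode' : ∀ τ ∈ Icc 0 T, deriv (deriv v) τ = v τ ^ 3 - s ^ 2 * v τ + cos (ε * τ) :=
      fun τ hτ ↦ hode τ ⟨hτ.1, hτ.2.trans hTT⟩
        ⟨h0 ▸ hmono.monotoneOn (left_mem_Icc.2 hT.le) hτ hτ.1, hle τ hτ⟩
    refine ⟨hpos, hode', lt_duffingTime hs hb hT hvdiff h0 (hle T (right_mem_Icc.2 hT.le)) hpos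
      fun t ht ↦ duffing_energy_lt hv hε ht.1
        ((mul_le_mul_of_nonneg_left ht.2 hε.le).trans hεT')
        (fun τ hτ ↦ hode' τ ⟨hτ.1, hτ.2.trans ht.2⟩) h0 h0'
        fun τ hτ ↦ hpos τ ⟨hτ.1, hτ.2.le.trans ht.2⟩⟩
  -- the level `b` is reached; otherwise `v < b` on all of `[0, T₀]`
  have hbelow : ∀ τ, 0 ≤ τ → (∀ t ∈ Icc 0 τ, v t ≠ b) → v τ < b := by
    intro τ hτ hne
    by_contra! h
    obtain ⟨t, ht, hvt⟩ := intermediate_value_Icc hτ hvc.continuousOn ⟨h0 ▸ hsb, h⟩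
    exact hne t ht hvt
  have hex : (Icc 0 T₀ ∩ {t | v t = b}).Nonempty := by
    by_contra! hemp
    have hne : ∀ t ∈ Icc 0 T₀, v t ≠ b := fun t ht h ↦
      (eq_empty_iff_forall_notMem.1 hemp t) ⟨ht, h⟩
    exact lt_irrefl _ (main T₀ hT₀ le_rfl fun τ hτ ↦
      (hbelow τ hτ.1 fun t ht ↦ hne t ⟨ht.1, ht.2.trans hτ.2⟩).le).2.2
  obtain ⟨T, ⟨⟨hTnn, hTT⟩, hvT⟩, hmin⟩ :=
    (isCompact_Icc.inter_right (isClosed_eq hvc continuous_const)).exists_isLeast hex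
  have hvT : v T = b := hvT
  have hT : 0 < T := by
    refine lt_of_le_of_ne hTnn fun h ↦ ?_
    rw [← h, h0] at hvT
    linarith
  have hle : ∀ τ ∈ Icc 0 T, v τ ≤ b := by
    intro τ hτ
    rcases hτ.2.eq_or_lt with rfl | hlt
    · exact hvT.le
    · exact (hbelow τ hτ.1 fun t ht h ↦ (ht.2.trans_lt hlt).not_ge
        (hmin ⟨⟨ht.1, ht.2.trans (hlt.le.trans hTT)⟩, h⟩)).le
  obtain ⟨hpos, hode', hlt⟩ := main T hT hTT hle
  exact ⟨T, hT, hlt, v, hv, hode', h0, h0', hpos, hvT⟩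

/-- Quantitative verification of Condition A: for `λ ≥ λ₀ = 3/2^(2/3)`,
`b = √(λ + 1/(2λ))`, and the explicit time `T_λ` from the paper, if
`0 < ε ≤ ε_λ = π/(3T_λ)` then the solution of
`v'' = v³ − λv + cos(ετ)`, `v(0) = −√λ`, `v'(0) = 0`
is defined up to some time `T ∈ (0, T_λ)` with `T ≤ π/(3ε)`, is strictly
increasing on `(0,T]`, and satisfies `v(T) = b`. -/
theorem stmt_9 (lam ε b Tlam εlam : ℝ)
    (hlam : (3 : ℝ) / (2 : ℝ) ^ ((2 : ℝ) / 3) ≤ lam)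
    (hb : b = Real.sqrt (lam + 1 / (2 * lam)))
    (hTlam : Tlam = if lam < 4 then 2 * Real.sqrt (b + Real.sqrt lam)
      else 2 * Real.sqrt 2 + Real.sqrt 2 * Real.log (Real.sqrt lam - 1) / Real.sqrt lam
        + 2 * (Real.sqrt (b + Real.sqrt lam) - Real.sqrt (2 * Real.sqrt lam - 2)))
    (hεlam : εlam = π / (3 * Tlam))
    (hε : 0 < ε) (hε2 : ε ≤ εlam) :
    ∃ T : ℝ, 0 < T ∧ T < Tlam ∧ T ≤ π / (3 * ε) ∧
      (∃ v : ℝ → ℝ, ContDiff ℝ 2 v ∧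
        (∀ τ ∈ Icc (0 : ℝ) T,
          deriv (deriv v) τ = v τ ^ 3 - lam * v τ + Real.cos (ε * τ)) ∧
        v 0 = -Real.sqrt lam ∧ deriv v 0 = 0 ∧
        (∀ τ ∈ Ioc (0 : ℝ) T, 0 < deriv v τ) ∧ v T = b) ∧
      (∀ v : ℝ → ℝ, ContDiff ℝ 2 v →
        (∀ τ ∈ Icc (0 : ℝ) T,
          deriv (deriv v) τ = v τ ^ 3 - lam * v τ + Real.cos (ε * τ)) →
        v 0 = -Real.sqrt lam → deriv v 0 = 0 →
        (∀ τ ∈ Ioc (0 : ℝ) T, 0 < deriv v τ) ∧ v T = b) := by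
  have hlam0 : 0 < lam := lt_of_lt_of_le (by positivity) hlam
  have hs : 0 < √lam := sqrt_pos.2 hlam0
  have hsq : √lam ^ 2 = lam := sq_sqrt hlam0.le
  have hsb : √lam ≤ b := hb ▸ sqrt_le_sqrt (le_add_of_nonneg_right (by positivity))
  have hiff : √lam < 2 ↔ lam < 4 := by
    rw [sqrt_lt' two_pos]
    norm_num
  have hTeq : Tlam = duffingTime (√lam) b := by
    simp only [hTlam, duffingTime, hiff]
  have hT₀ : 0 < Tlam := hTeq ▸ duffingTime_pos hs hsb
  have hεT : ε * Tlam ≤ π / 3 := by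
    rw [hεlam, le_div_iff₀ (by positivity)] at hε2
    linarith
  obtain ⟨T, hT, hlt, v, hv, hode, h0, h0', hpos, hvT⟩ :=
    duffing_reaches hs hsb hε (hTeq ▸ hεT)
  rw [← hTeq] at hlt
  rw [hsq] at hode
  refine ⟨T, hT, hlt, ?_, ⟨v, hv, hode, h0, h0', hpos, hvT⟩, fun w hw hwode hw0 hw0' ↦ ?_⟩
  · rw [le_div_iff₀ (by positivity)]
    nlinarith [mul_lt_mul_of_pos_left hlt hε]
  · obtain ⟨h1, h2⟩ := eqOn_of_second_order_ode (g := fun x ↦ x ^ 3 - lam * x)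
      (p := fun t ↦ cos (ε * t)) (by fun_prop) hw hv hwode hode (hw0.trans h0.symm)
      (hw0'.trans h0'.symm)
    exact ⟨fun τ hτ ↦ h2 (Ioc_subset_Icc_self hτ) ▸ hpos τ hτ,
      (h1 (right_mem_Icc.2 hT.le)).trans hvT⟩
end
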